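/- arXiv:2009.09530 — 2 statements merged into one kernel-verified Lean document; each statement's English description precedes it below -/
import Mathlib

section
/- Let U be a normal ultrafilter on a measurable cardinal δ and let κ > δ be a regular cardinal. If there exists a □(κ)-sequence, then there is a closed unbounded subset of j_U(κ) that is fresh over Ult(V,U). -/
noncomputable section

open Cardinal Set

namespace MU

/-- The type of ordinals below the initial ordinal of `δ`, serving as the underlying
set of the cardinal `δ` and indexing the ultrapower. -/
abbrev Idx (δ : Cardinal.{0}) : Type 1 := {o : Ordinal.{0} // o < δ.ord}

/-- A filter `F` is `κ`-complete (equivalently, `<κ`-closed): it is closed under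
intersections of fewer than `κ` of its members. -/
def IsCComplete (κ : Cardinal.{0}) {X : Type*} (F : Filter X) : Prop :=
  ∀ (ι : Type) (t : ι → Set X), #ι < κ → (∀ j, t j ∈ F) → (⋂ j, t j) ∈ F

/-- `U` is a normal ultrafilter on the measurable cardinal `δ`: `δ` is uncountable and
`U` is a `δ`-complete nonprincipal ultrafilter on `δ` such that every function that is
regressive on a set in `U` is constant on a set in `U`. -/
structure IsNormalUltrafilter (δ : Cardinal.{0}) (U : Ultrafilter (Idx δ)) : Prop where
  uncountable : ℵ₀ < δ
  complete : IsCComplete δ (U : Filter (Idx δ))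
  nonprincipal : ∀ i : Idx δ, ({i} : Set (Idx δ)) ∉ U
  normal : ∀ f : Idx δ → Ordinal.{0}, { i : Idx δ | f i < i.1 } ∈ U →
    ∃ c : Ordinal.{0}, { i : Idx δ | f i = c } ∈ U

variable {δ : Cardinal.{0}} {U : Ultrafilter (Idx δ)}

/-- The Łoś ordering on representatives of ordinals of the ultrapower `Ult(V,U)`. -/
def ultLT (U : Ultrafilter (Idx δ)) (f g : Idx δ → Ordinal.{0}) : Prop :=
  { i : Idx δ | f i < g i } ∈ U

theorem ultLT_wf (hU : IsNormalUltrafilter δ U) : WellFounded (ultLT U) := by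
  haveI : IsIrrefl (Idx δ → Ordinal.{0}) (ultLT U) := by
    constructor
    intro f hf
    have h : ({ i : Idx δ | f i < f i } : Set (Idx δ)) = ∅ := by ext i; simp
    rw [ultLT, h] at hf
    exact Filter.empty_notMem (U : Filter (Idx δ)) hf
  haveI : IsTrans (Idx δ → Ordinal.{0}) (ultLT U) := by
    constructor
    intro f g h hfg hgh
    have hsub : ({ i : Idx δ | f i < g i } ∩ { i : Idx δ | g i < h i } : Set (Idx δ)) ⊆
        { i : Idx δ | f i < h i } := fun i hi => show f i < h i from lt_trans hi.1 hi.2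
    exact Filter.mem_of_superset (Filter.inter_mem hfg hgh) hsub
  haveI : IsStrictOrder (Idx δ → Ordinal.{0}) (ultLT U) := ⟨⟩
  rw [RelEmbedding.wellFounded_iff_isEmpty]
  constructor
  intro g
  have hmem : ∀ n : ℕ, { i : Idx δ | g (n + 1) i < g n i } ∈ U :=
    fun n => g.map_rel_iff.2 (Nat.lt_succ_self n)
  have hint : (⋂ n : ℕ, { i : Idx δ | g (n + 1) i < g n i }) ∈ U := by
    refine hU.complete ℕ _ ?_ hmem
    rw [Cardinal.mk_nat]
    exact hU.uncountable
  obtain ⟨i, hi⟩ := Ultrafilter.nonempty_of_mem hint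
  have hdesc : ∀ n : ℕ, (fun n => g n i) (n + 1) < (fun n => g n i) n :=
    fun n => Set.mem_iInter.1 hi n
  exact (RelEmbedding.wellFounded_iff_isEmpty.1 Ordinal.lt_wf).false
    (RelEmbedding.natGT (fun n => g n i) hdesc)

/-- The ordinal represented by `f` in the transitive collapse of the ultrapower
`Ult(V,U)`, i.e. the rank of `f` in the (well-founded) Łoś ordering. -/
def ordRank (hU : IsNormalUltrafilter δ U) (f : Idx δ → Ordinal.{0}) : Ordinal.{0} :=
  sInf { o : Ordinal.{0} | Ordinal.lift.{1} o = ((ultLT_wf hU).apply f).rank }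

/-- The image of an ordinal under the ultrapower embedding `j_U : V → Ult(V,U)`. -/
def jU (hU : IsNormalUltrafilter δ U) (o : Ordinal.{0}) : Ordinal.{0} :=
  ordRank hU fun _ => o

/-- The set of ordinals that is the transitive collapse of the element of the
ultrapower `Ult(V,U)` represented by the function `f`. -/
def ultSet (hU : IsNormalUltrafilter δ U) (f : Idx δ → Set Ordinal.{0}) :
    Set Ordinal.{0} :=
  { o : Ordinal.{0} |
    ∃ g : Idx δ → Ordinal.{0}, { i : Idx δ | g i ∈ f i } ∈ U ∧ ordRank hU g = o }

/-- A set of ordinals is (the transitive collapse of) an element of the ultrapower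
`Ult(V,U)`. -/
def InUlt (hU : IsNormalUltrafilter δ U) (A : Set Ordinal.{0}) : Prop :=
  ∃ f : Idx δ → Set Ordinal.{0}, (∀ i, BddAbove (f i)) ∧ A = ultSet hU f

/-- The least upper bound of a set of ordinals. -/
def lub (A : Set Ordinal.{0}) : Ordinal.{0} :=
  sSup ((fun o => o + 1) '' A)

/-- Hamkins: a set `A` of ordinals is fresh over `Ult(V,U)` if `A ∉ Ult(V,U)` but
`A ∩ α ∈ Ult(V,U)` for every `α < lub A`. -/
def Fresh (hU : IsNormalUltrafilter δ U) (A : Set Ordinal.{0}) : Prop :=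
  ¬ InUlt hU A ∧ ∀ α < lub A, InUlt hU (A ∩ Iio α)

/-- `A` is an unbounded subset of the ordinal `l`. -/
def UnbSub (A : Set Ordinal.{0}) (l : Ordinal.{0}) : Prop :=
  A ⊆ Iio l ∧ ∀ b < l, ∃ a ∈ A, b ≤ a

/-- `A` is a closed subset of the ordinal `l`: it contains the suprema of all of its
nonempty subsets that are bounded below `l`. -/
def ClosedIn (A : Set Ordinal.{0}) (l : Ordinal.{0}) : Prop :=
  ∀ S ⊆ A, S.Nonempty → sSup S < l → sSup S ∈ A

/-- The set of limit points of a set of ordinals. -/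
def limitPts (A : Set Ordinal.{0}) : Set Ordinal.{0} :=
  { b : Ordinal.{0} | (A ∩ Iio b).Nonempty ∧ sSup (A ∩ Iio b) = b }

/-- `S` is a stationary subset of the ordinal `l`. -/
def StationaryIn (S : Set Ordinal.{0}) (l : Ordinal.{0}) : Prop :=
  S ⊆ Iio l ∧ ∀ D : Set Ordinal.{0}, ClosedIn D l → UnbSub D l → (S ∩ D).Nonempty

/-- The order type of the set of ordinals `C` is at most `o`. -/
def otpLE (C : Set Ordinal.{0}) (o : Ordinal.{0}) : Prop :=
  ∃ g : Ordinal.{0} → Ordinal.{0}, (∀ a ∈ C, g a < o) ∧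
    ∀ a ∈ C, ∀ b ∈ C, a < b → g a < g b

/-- The order type of the set of ordinals `C` is (strictly) less than `o`. -/
def otpLT (C : Set Ordinal.{0}) (o : Ordinal.{0}) : Prop :=
  ∃ o' < o, otpLE C o'

/-- `C` is a `□(Θ)`-sequence, where `Θ` is (the initial ordinal of) an uncountable
regular cardinal. -/
structure IsSquareSeq (Θ : Ordinal.{0}) (C : Ordinal.{0} → Set Ordinal.{0}) : Prop where
  closed : ∀ γ < Θ, Order.IsSuccLimit γ → ClosedIn (C γ) γ
  unbounded : ∀ γ < Θ, Order.IsSuccLimit γ → UnbSub (C γ) γ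
  coherent : ∀ γ < Θ, Order.IsSuccLimit γ → ∀ β ∈ limitPts (C γ), β < γ → C β = C γ ∩ Iio β
  nontrivial : ¬ ∃ D : Set Ordinal.{0}, ClosedIn D Θ ∧ UnbSub D Θ ∧
    ∀ γ ∈ limitPts D, γ < Θ → D ∩ Iio γ = C γ

/-- `C` is a `□_κ`-sequence: a `□(κ⁺)`-sequence all of whose clubs have order type
at most `κ`. -/
def IsSquareKappaSeq (κ : Cardinal.{0}) (C : Ordinal.{0} → Set Ordinal.{0}) : Prop :=
  IsSquareSeq (Order.succ κ).ord C ∧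
    ∀ γ < (Order.succ κ).ord, Order.IsSuccLimit γ → otpLE (C γ) κ.ord

/-- `κ` is a weakly compact cardinal: `κ` is uncountable and every coloring of the
pairs of ordinals below `κ` in fewer than `κ` colors has a homogeneous set of size `κ`. -/
def IsWeaklyCompact (κ : Cardinal.{0}) : Prop :=
  ℵ₀ < κ ∧ ∀ (ν : Type) (c : Ordinal.{0} → Ordinal.{0} → ν), #ν < κ →
    ∃ H : Set Ordinal.{0}, H ⊆ Iio κ.ord ∧ Cardinal.lift.{1} κ ≤ #H ∧
      ∀ a ∈ H, ∀ b ∈ H, ∀ a' ∈ H, ∀ b' ∈ H, a < b → a' < b' → c a b = c a' b'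

/-- `κ` is a strongly compact cardinal: every `κ`-complete filter (on any set)
extends to a `κ`-complete ultrafilter. -/
def IsStronglyCompact (κ : Cardinal.{0}) : Prop :=
  ∀ (X : Type) (F : Filter X), IsCComplete κ F →
    ∃ G : Ultrafilter X, F ≤ (G : Filter X) ∧ IsCComplete κ (G : Filter X)

/-- `κ` is a singular cardinal. -/
def IsSingular (κ : Cardinal.{0}) : Prop :=
  ℵ₀ ≤ κ ∧ κ.ord.cof < κ

/-- The cofinality of the ordinal `l` as computed inside the ultrapower `Ult(V,U)`
(as an ordinal, i.e. the image of the ultrapower's cofinality under the transitive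
collapse). -/
def cofUlt (hU : IsNormalUltrafilter δ U) (l : Ordinal.{0}) : Ordinal.{0} :=
  sInf { c : Ordinal.{0} | ∃ f : Idx δ → Ordinal.{0},
    ordRank hU f = l ∧ ordRank hU (fun i => ((f i).cof).ord) = c }

/-- The ordinal `o` is (the transitive collapse of) a cardinal of the ultrapower
`Ult(V,U)`. -/
def CardInUlt (hU : IsNormalUltrafilter δ U) (o : Ordinal.{0}) : Prop :=
  ∃ f : Idx δ → Ordinal.{0}, ordRank hU f = o ∧
    { i : Idx δ | ((f i).card).ord = f i } ∈ U

/-- The ordinal `o` is (the transitive collapse of) a regular cardinal of the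
ultrapower `Ult(V,U)`. -/
def RegularInUlt (hU : IsNormalUltrafilter δ U) (o : Ordinal.{0}) : Prop :=
  ∃ f : Idx δ → Ordinal.{0}, ordRank hU f = o ∧
    { i : Idx δ | ((f i).card).IsRegular ∧ ((f i).card).ord = f i } ∈ U

/-- The cardinal successor of the ordinal `o` as computed inside the ultrapower
`Ult(V,U)`: the least ordinal above `o` that is a cardinal in `Ult(V,U)`. -/
def succInUlt (hU : IsNormalUltrafilter δ U) (o : Ordinal.{0}) : Ordinal.{0} :=
  sInf { c : Ordinal.{0} | o < c ∧ CardInUlt hU c }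

/-- The cardinality of a set of ordinals, as an (initial) ordinal: the least ordinal
`o` such that `s` is the image of a function defined on the ordinals below `o`. -/
def setCardOrd (s : Set Ordinal.{0}) : Ordinal.{0} :=
  sInf { o : Ordinal.{0} | ∃ g : Ordinal.{0} → Ordinal.{0}, s ⊆ g '' Iio o }

/-! ### Ordinals of the ultrapower -/

theorem bounded_of_small {ι : Type*} [Small.{0} ι] (f : ι → Ordinal.{0}) :
    ∃ b, ∀ i, f i < b := by
  obtain ⟨b, hb⟩ := Ordinal.bddAbove_of_small (s := range f)
  exact ⟨b + 1, fun i => (hb ⟨i, rfl⟩).trans_lt (lt_add_one b)⟩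

instance : Small.{0} (Idx δ) := Ordinal.small_Iio δ.ord

theorem rank_congr (hU : IsNormalUltrafilter δ U) {f g : Idx δ → Ordinal.{0}}
    (h : ∀ᶠ i in U, f i = g i) :
    ((ultLT_wf hU).apply f).rank = ((ultLT_wf hU).apply g).rank := by
  have key : ∀ {f g : Idx δ → Ordinal.{0}}, (∀ᶠ i in U, f i = g i) →
      ((ultLT_wf hU).apply f).rank ≤ ((ultLT_wf hU).apply g).rank := by
    intro f g h
    rw [Acc.rank_eq]
    refine Ordinal.iSup_le fun b => Order.succ_le_of_lt ?_
    apply Acc.rank_lt_of_rel ((ultLT_wf hU).apply g)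
    have hb : ∀ᶠ i in U, b.1 i < f i := b.2
    change ∀ᶠ i in U, b.1 i < g i
    filter_upwards [h, hb] with i h1 h2
    rwa [← h1]
  exact le_antisymm (key h) (key (h.mono fun _ => Eq.symm))

theorem rank_mem_range_lift (hU : IsNormalUltrafilter δ U) (f : Idx δ → Ordinal.{0}) :
    ∃ o : Ordinal.{0}, Ordinal.lift.{1} o = ((ultLT_wf hU).apply f).rank := by
  by_contra hno
  have hlt : ∀ o : Ordinal.{0}, Ordinal.lift.{1} o < ((ultLT_wf hU).apply f).rank := by
    intro o
    by_contra! hle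
    obtain ⟨o', ho'⟩ := Ordinal.mem_range_lift_of_le hle
    exact hno ⟨o', ho'⟩
  obtain ⟨b, hb⟩ := bounded_of_small f
  have hex : ∀ o : Ordinal.{0}, ∃ g : Idx δ → Iio b,
      ((ultLT_wf hU).apply fun i => (g i).1).rank = Ordinal.lift.{1} o := by
    intro o
    have hlt' := hlt o
    rw [Acc.rank_eq, Ordinal.lt_iSup_iff] at hlt'
    obtain ⟨⟨g, hg⟩, hog⟩ := hlt'
    obtain ⟨h, hacc, hh⟩ := Acc.mem_range_rank_of_le _ (Order.lt_succ_iff.1 hog)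
    have hhf : ∀ᶠ i in U, h i < f i := by
      by_contra hcon
      have hcon' : ∀ᶠ i in U, f i ≤ h i :=
        (Ultrafilter.eventually_not.2 hcon).mono fun i hi => not_lt.1 hi
      have hle : ((ultLT_wf hU).apply f).rank ≤ ((ultLT_wf hU).apply h).rank := by
        rw [Acc.rank_eq]
        refine Ordinal.iSup_le fun c => Order.succ_le_of_lt ?_
        apply Acc.rank_lt_of_rel ((ultLT_wf hU).apply h)
        have hc : ∀ᶠ i in U, c.1 i < f i := c.2
        change ∀ᶠ i in U, c.1 i < h i
        filter_upwards [hcon', hc] with i h1 h2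
        exact h2.trans_le h1
      exact (hle.trans_eq hh).not_gt (hlt o)
    have hb0 : (0 : Ordinal.{0}) < b := by
      obtain ⟨i, -⟩ := U.nonempty_of_mem hhf
      exact (zero_le).trans_lt (hb i)
    refine ⟨fun i => if hi : h i < f i then ⟨h i, hi.trans (hb i)⟩ else ⟨0, hb0⟩, ?_⟩
    rw [← hh]
    apply rank_congr hU
    filter_upwards [hhf] with i hi
    simp [hi]
  choose g hg using hex
  have hinj : Function.Injective g := by
    intro o o' h
    have h' := hg o
    rw [h, hg o'] at h'
    exact (Ordinal.lift_inj.1 h').symm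
  exact not_small_ordinal.{0, 0} (small_of_injective hinj)

theorem lift_ordRank (hU : IsNormalUltrafilter δ U) (f : Idx δ → Ordinal.{0}) :
    Ordinal.lift.{1} (ordRank hU f) = ((ultLT_wf hU).apply f).rank :=
  csInf_mem (s := { o : Ordinal.{0} | Ordinal.lift.{1} o = ((ultLT_wf hU).apply f).rank })
    (rank_mem_range_lift hU f)

theorem ordRank_congr (hU : IsNormalUltrafilter δ U) {f g : Idx δ → Ordinal.{0}}
    (h : ∀ᶠ i in U, f i = g i) : ordRank hU f = ordRank hU g := by
  unfold ordRank
  rw [rank_congr hU h]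

theorem ordRank_lt_of_eventually_lt (hU : IsNormalUltrafilter δ U) {f g : Idx δ → Ordinal.{0}}
    (h : ∀ᶠ i in U, f i < g i) : ordRank hU f < ordRank hU g := by
  rw [← Ordinal.lift_lt.{1}, lift_ordRank, lift_ordRank]
  exact Acc.rank_lt_of_rel ((ultLT_wf hU).apply g) h

theorem ordRank_le_of_eventually_le (hU : IsNormalUltrafilter δ U) {f g : Idx δ → Ordinal.{0}}
    (h : ∀ᶠ i in U, f i ≤ g i) : ordRank hU f ≤ ordRank hU g := by
  rcases Ultrafilter.eventually_or.1 (h.mono fun i hi => hi.lt_or_eq) with h | h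
  · exact (ordRank_lt_of_eventually_lt hU h).le
  · exact (ordRank_congr hU h).le

theorem ordRank_lt_iff (hU : IsNormalUltrafilter δ U) {f g : Idx δ → Ordinal.{0}} :
    ordRank hU f < ordRank hU g ↔ ∀ᶠ i in U, f i < g i := by
  refine ⟨fun h => ?_, ordRank_lt_of_eventually_lt hU⟩
  by_contra hcon
  exact (ordRank_le_of_eventually_le hU
    ((Ultrafilter.eventually_not.2 hcon).mono fun i hi => not_lt.1 hi)).not_gt h

theorem ordRank_eq_iff (hU : IsNormalUltrafilter δ U) {f g : Idx δ → Ordinal.{0}} :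
    ordRank hU f = ordRank hU g ↔ ∀ᶠ i in U, f i = g i := by
  refine ⟨fun h => ?_, ordRank_congr hU⟩
  by_contra hcon
  rcases Ultrafilter.eventually_or.1
    ((Ultrafilter.eventually_not.2 hcon).mono fun i hi => lt_or_gt_of_ne hi) with h' | h'
  · exact (ordRank_lt_of_eventually_lt hU h').ne h
  · exact (ordRank_lt_of_eventually_lt hU h').ne' h

theorem exists_ordRank_eq_of_lt (hU : IsNormalUltrafilter δ U) {f : Idx δ → Ordinal.{0}}
    {o : Ordinal.{0}} (h : o < ordRank hU f) : ∃ g, ordRank hU g = o := by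
  have h' := (Ordinal.lift_lt.{1}).2 h
  rw [lift_ordRank] at h'
  obtain ⟨g, _, hg⟩ := Acc.mem_range_rank_of_le _ h'.le
  exact ⟨g, Ordinal.lift_inj.{1}.1 ((lift_ordRank hU g).trans hg)⟩

theorem ordRank_mem_ultSet (hU : IsNormalUltrafilter δ U) {f : Idx δ → Set Ordinal.{0}}
    {g : Idx δ → Ordinal.{0}} : ordRank hU g ∈ ultSet hU f ↔ ∀ᶠ i in U, g i ∈ f i := by
  constructor
  · rintro ⟨h, hh, hhg⟩
    have hh' : ∀ᶠ i in U, h i ∈ f i := hh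
    filter_upwards [hh', (ordRank_eq_iff hU).1 hhg] with i h1 h2
    rwa [← h2]
  · exact fun h => ⟨g, h, rfl⟩

theorem ultSet_subset_iff (hU : IsNormalUltrafilter δ U) {F G : Idx δ → Set Ordinal.{0}} :
    ultSet hU F ⊆ ultSet hU G ↔ ∀ᶠ i in U, F i ⊆ G i := by
  classical
  constructor
  · intro h
    by_contra hcon
    have hcon' := Ultrafilter.eventually_not.2 hcon
    have : ∀ i, ∃ x, ¬ F i ⊆ G i → x ∈ F i ∧ x ∉ G i := by
      intro i
      by_cases hi : F i ⊆ G i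
      · exact ⟨0, fun h => absurd hi h⟩
      · obtain ⟨x, hx⟩ := Set.not_subset.1 hi
        exact ⟨x, fun _ => hx⟩
    choose g hg using this
    have h1 : ordRank hU g ∈ ultSet hU F :=
      (ordRank_mem_ultSet hU).2 (hcon'.mono fun i hi => (hg i hi).1)
    have h2 := (ordRank_mem_ultSet hU).1 (h h1)
    obtain ⟨i, hi, hi'⟩ := (h2.and hcon').exists
    exact (hg i hi').2 hi
  · rintro h _ ⟨g, hg, rfl⟩
    have hg' : ∀ᶠ i in U, g i ∈ F i := hg
    exact (ordRank_mem_ultSet hU).2 (by filter_upwards [h, hg'] with i h1 h2 using h1 h2)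

theorem ultSet_eq_iff (hU : IsNormalUltrafilter δ U) {F G : Idx δ → Set Ordinal.{0}} :
    ultSet hU F = ultSet hU G ↔ ∀ᶠ i in U, F i = G i := by
  rw [Set.Subset.antisymm_iff, ultSet_subset_iff, ultSet_subset_iff, ← Filter.eventually_and]
  simp only [Set.Subset.antisymm_iff]

theorem ultSet_inter_Iio (hU : IsNormalUltrafilter δ U) (F : Idx δ → Set Ordinal.{0})
    (a : Idx δ → Ordinal.{0}) :
    ultSet hU F ∩ Iio (ordRank hU a) = ultSet hU fun i => F i ∩ Iio (a i) := by
  ext o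
  constructor
  · rintro ⟨⟨g, hg, rfl⟩, ho⟩
    have hg' : ∀ᶠ i in U, g i ∈ F i := hg
    refine (ordRank_mem_ultSet hU).2 ?_
    filter_upwards [hg', (ordRank_lt_iff hU).1 ho] with i h1 h2 using ⟨h1, h2⟩
  · rintro ⟨g, hg, rfl⟩
    have hg' : ∀ᶠ i in U, g i ∈ F i ∩ Iio (a i) := hg
    exact ⟨(ordRank_mem_ultSet hU).2 (hg'.mono fun i hi => hi.1),
      (ordRank_lt_iff hU).2 (hg'.mono fun i hi => hi.2)⟩

/-! ### Bounds below a regular cardinal -/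

theorem IsRegular.exists_bound {κ : Cardinal.{0}} (hreg : κ.IsRegular) {ι : Type 1}
    (hι : #ι < Cardinal.lift.{1} κ) (f : ι → Ordinal.{0}) (hf : ∀ i, f i < κ.ord) :
    ∃ b < κ.ord, ∀ i, f i ≤ b := by
  have hsm : Small.{0} ι := by
    rw [Cardinal.small_iff_lift_mk_lt_univ]
    simpa using hι.trans (Cardinal.lift_lt_univ κ)
  refine ⟨⨆ i, f i, Ordinal.lift_iSup_lt_of_lt_cof ?_ hf, fun i => ?_⟩
  · have h : (Ordinal.lift.{1} κ.ord).cof = Cardinal.lift.{1} κ := by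
      rw [← Ordinal.lift_cof, hreg.cof_ord]
    rw [h]
    simpa using hι
  · exact le_ciSup (Ordinal.bddAbove_of_small (s := range f)) i

theorem IsRegular.exists_bound_Iio {κ : Cardinal.{0}} (hreg : κ.IsRegular) {β : Ordinal.{0}}
    (hβ : β < κ.ord) (f : Ordinal.{0} → Ordinal.{0}) (hf : ∀ α < β, f α < κ.ord) :
    ∃ b < κ.ord, ∀ α < β, f α ≤ b := by
  obtain ⟨b, hb, h⟩ := IsRegular.exists_bound hreg (ι := Iio β)
    (by rw [Cardinal.mk_Iio_ordinal]; exact Cardinal.lift_lt.2 (Cardinal.lt_ord.1 hβ))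
    (fun α => f α.1) fun α => hf _ α.2
  exact ⟨b, hb, fun α hα => h ⟨α, hα⟩⟩

theorem mk_Idx (δ : Cardinal.{0}) : #(Idx δ) = Cardinal.lift.{1} δ := by
  change #(Iio δ.ord) = _
  rw [Cardinal.mk_Iio_ordinal, Cardinal.card_ord]

theorem IsRegular.exists_bound_Idx {κ : Cardinal.{0}} (hreg : κ.IsRegular) (hκ : δ < κ)
    (f : Idx δ → Ordinal.{0}) (hf : ∀ i, f i < κ.ord) : ∃ b < κ.ord, ∀ i, f i ≤ b :=
  IsRegular.exists_bound hreg (by rw [mk_Idx]; simpa using hκ) f hf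

theorem IsRegular.add_one_lt {κ : Cardinal.{0}} (hreg : κ.IsRegular) {a : Ordinal.{0}}
    (ha : a < κ.ord) : a + 1 < κ.ord :=
  (Cardinal.isSuccLimit_ord hreg.aleph0_le).add_one_lt ha

theorem exists_lt_jU (hU : IsNormalUltrafilter δ U) {κ : Cardinal.{0}} (hκ : δ < κ)
    (hreg : κ.IsRegular) {o : Ordinal.{0}} (ho : o < jU hU κ.ord) :
    ∃ g : Idx δ → Ordinal.{0}, ordRank hU g = o ∧ ∃ β < κ.ord, ∀ i, g i < β := by
  obtain ⟨g, rfl⟩ := exists_ordRank_eq_of_lt hU ho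
  have hg := (ordRank_lt_iff hU).1 ho
  have hpos : 0 < κ.ord := hreg.ord_pos
  let g' : Idx δ → Ordinal.{0} := fun i => if g i < κ.ord then g i else 0
  obtain ⟨b, hb, hgb⟩ := IsRegular.exists_bound_Idx hreg hκ g' fun i => by
    by_cases h : g i < κ.ord <;> simp [g', h, hpos]
  refine ⟨g', ordRank_congr hU ?_, b + 1, IsRegular.add_one_lt hreg hb,
    fun i => (hgb i).trans_lt (lt_add_one b)⟩
  filter_upwards [hg] with i hi
  simp [g', hi]

/-- A system of sets that is coherent modulo `U`, is not induced by a single sequence, and contains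
all ordinals that are not successors represents a fresh club. -/
theorem exists_fresh_of_coherent (hU : IsNormalUltrafilter δ U) {κ : Cardinal.{0}} (hκ : δ < κ)
    (hreg : κ.IsRegular) (Y : Ordinal.{0} → Idx δ → Set Ordinal.{0})
    (hsub : ∀ β i, Y β i ⊆ Iio β)
    (hcoh : ∀ β < κ.ord, ∀ γ < β, ∀ᶠ i in U, Y β i ∩ Iio γ = Y γ i)
    (hlim : ∀ β i, ∀ α < β, (∀ c, c + 1 ≠ α) → α ∈ Y β i)
    (hnon : ¬ ∃ F : Idx δ → Set Ordinal.{0}, ∀ β < κ.ord, ∀ᶠ i in U, F i ∩ Iio β = Y β i) :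
    ∃ A : Set Ordinal.{0}, ClosedIn A (jU hU κ.ord) ∧ UnbSub A (jU hU κ.ord) ∧
      Fresh hU A := by
  classical
  let A : Set Ordinal.{0} := { o | ∃ β < κ.ord, o ∈ ultSet hU (Y β) }
  have hAβ : ∀ β < κ.ord, A ∩ Iio (jU hU β) = ultSet hU (Y β) := by
    intro β hβ
    ext o
    constructor
    · rintro ⟨⟨γ, hγ, ho⟩, hoβ⟩
      rcases lt_trichotomy γ β with h | rfl | h
      · refine (ultSet_subset_iff hU).2 ?_ ho
        filter_upwards [hcoh β hβ γ h] with i hi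
        exact hi ▸ inter_subset_left
      · exact ho
      · have h1 : o ∈ ultSet hU (Y γ) ∩ Iio (jU hU β) := ⟨ho, hoβ⟩
        rw [jU, ultSet_inter_Iio, (ultSet_eq_iff hU).2 (hcoh γ hγ β h)] at h1
        exact h1
    · intro ho
      refine ⟨⟨β, hβ, ho⟩, ?_⟩
      obtain ⟨g, hg, rfl⟩ := ho
      have hg' : ∀ᶠ i in U, g i ∈ Y β i := hg
      exact (ordRank_lt_iff hU).2 (hg'.mono fun i hi => hsub β i hi)
  have hAsub : A ⊆ Iio (jU hU κ.ord) := by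
    rintro o ⟨β, hβ, ho⟩
    have h := (hAβ β hβ).ge ho
    exact h.2.trans ((ordRank_lt_iff hU).2 (Filter.Eventually.of_forall fun _ => hβ))
  refine ⟨A, ?_, ⟨hAsub, ?_⟩, ?_, ?_⟩
  · intro S hS hne hlt
    by_contra hcon
    obtain ⟨g, hg, β, hβ, hgβ⟩ := exists_lt_jU hU hκ hreg hlt
    have hsucc : ∀ᶠ i in U, ∃ c, c + 1 = g i := by
      by_contra hnot
      refine hcon (hg ▸ ⟨β, hβ, (ordRank_mem_ultSet hU).2 ?_⟩)
      filter_upwards [Ultrafilter.eventually_not.2 hnot] with i hi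
      exact hlim β i _ (hgβ i) fun c hc => hi ⟨c, hc⟩
    let h : Idx δ → Ordinal.{0} := fun i => if hi : ∃ c, c + 1 = g i then hi.choose else 0
    have hh : ∀ᶠ i in U, h i + 1 = g i := by
      filter_upwards [hsucc] with i hi
      simp only [h, hi, dif_pos]
      exact hi.choose_spec
    have hle : sSup S ≤ ordRank hU h := by
      refine csSup_le hne fun s hs => ?_
      have hbdd : BddAbove S := ⟨jU hU κ.ord, fun x hx => (hAsub (hS hx)).le⟩
      have hs1 : s < sSup S :=
        lt_of_le_of_ne (le_csSup hbdd hs) fun heq => hcon (heq ▸ hS hs)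
      rw [← hg] at hs1
      obtain ⟨f, rfl⟩ := exists_ordRank_eq_of_lt hU hs1
      apply ordRank_le_of_eventually_le hU
      filter_upwards [(ordRank_lt_iff hU).1 hs1, hh] with i h1 h2
      rw [← h2] at h1
      exact Order.lt_add_one_iff.1 h1
    refine hle.not_gt ?_
    rw [← hg]
    apply ordRank_lt_of_eventually_lt hU
    filter_upwards [hh] with i hi
    rw [← hi]
    exact lt_add_one _
  · intro o ho
    obtain ⟨g, rfl, β, hβ, hgβ⟩ := exists_lt_jU hU hκ hreg ho
    have hβ' : β + Ordinal.omega0 < κ.ord :=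
      (Ordinal.isPrincipal_add_ord hreg.aleph0_le) hβ
        (by rw [← Cardinal.ord_aleph0, Cardinal.ord_lt_ord]; exact hU.uncountable.trans hκ)
    refine ⟨jU hU (β + Ordinal.omega0), ⟨β + Ordinal.omega0 + 1, IsRegular.add_one_lt hreg hβ',
      (ordRank_mem_ultSet hU).2 (Filter.Eventually.of_forall fun i =>
        hlim _ i _ (lt_add_one _) fun c hc => ?_)⟩,
      ordRank_le_of_eventually_le hU (Filter.Eventually.of_forall fun i =>
        (hgβ i).le.trans le_self_add)⟩
    have hlimit := Ordinal.isSuccLimit_add β Ordinal.isSuccLimit_omega0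
    exact (hlimit.add_one_lt ((lt_add_one c).trans_eq hc)).ne hc
  · rintro ⟨F, -, hF⟩
    refine hnon ⟨F, fun β hβ => ?_⟩
    rw [← ultSet_eq_iff hU, ← ultSet_inter_Iio hU F fun _ => β, ← hF]
    exact hAβ β hβ
  · intro α hα
    have hα' : α < jU hU κ.ord := by
      refine hα.trans_le (csSup_le' ?_)
      rintro _ ⟨o, ho, rfl⟩
      exact Order.add_one_le_of_lt (hAsub ho)
    obtain ⟨g, rfl, β, hβ, hgβ⟩ := exists_lt_jU hU hκ hreg hα'
    refine ⟨fun i => Y β i ∩ Iio (g i), fun i => ⟨β, fun x hx => (hsub β i hx.1).le⟩, ?_⟩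
    rw [← ultSet_inter_Iio, ← hAβ β hβ, inter_assoc, Iio_inter_Iio, min_eq_right]
    exact (ordRank_lt_of_eventually_lt hU (Filter.Eventually.of_forall hgβ)).le

/-! ### Walks along coherent sequences -/

theorem mem_limitPts_iff {A : Set Ordinal.{0}} {b : Ordinal.{0}} :
    b ∈ limitPts A ↔ b ≠ 0 ∧ ∀ a < b, ∃ x ∈ A, a < x ∧ x < b := by
  constructor
  · rintro ⟨⟨x, hx⟩, hsup⟩
    refine ⟨(zero_le.trans_lt hx.2).ne', fun a ha => ?_⟩
    rw [← hsup] at ha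
    obtain ⟨y, hy, hay⟩ := exists_lt_of_lt_csSup ⟨x, hx⟩ ha
    exact ⟨y, hy.1, hay, hy.2⟩
  · rintro ⟨h0, h⟩
    obtain ⟨x, hx, -, hxb⟩ := h 0 (pos_iff_ne_zero.2 h0)
    have hne : (A ∩ Iio b).Nonempty := ⟨x, hx, hxb⟩
    refine ⟨hne, le_antisymm (csSup_le hne fun y hy => hy.2.le) ?_⟩
    by_contra! hlt
    obtain ⟨y, hy, hy1, hy2⟩ := h _ hlt
    exact (le_csSup (s := A ∩ Iio b) ⟨b, fun z hz => hz.2.le⟩ ⟨hy, hy2⟩).not_gt hy1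

theorem isSuccLimit_of_mem_limitPts {A : Set Ordinal.{0}} {b : Ordinal.{0}}
    (h : b ∈ limitPts A) : Order.IsSuccLimit b := by
  obtain ⟨h0, h⟩ := mem_limitPts_iff.1 h
  refine ⟨by simpa using h0, Order.isSuccPrelimit_of_succ_lt fun a ha => ?_⟩
  obtain ⟨x, -, hax, hxb⟩ := h a ha
  exact (Order.succ_le_of_lt hax).trans_lt hxb

theorem exists_bound_of_notMem_limitPts {A : Set Ordinal.{0}} {b : Ordinal.{0}} (hb : b ≠ 0)
    (h : b ∉ limitPts A) : ∃ a < b, ∀ x ∈ A, x < b → x ≤ a := by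
  rw [mem_limitPts_iff] at h
  push Not at h
  obtain ⟨a, ha, h⟩ := h hb
  exact ⟨a, ha, fun x hx hxb => not_lt.1 fun hax => (h x hx hax).not_gt hxb⟩

theorem limitPts_inter_Iio {A : Set Ordinal.{0}} {b c : Ordinal.{0}} (h : b ≤ c) :
    b ∈ limitPts (A ∩ Iio c) ↔ b ∈ limitPts A := by
  simp only [mem_limitPts_iff]
  refine and_congr_right fun _ => forall₂_congr fun a _ => ?_
  exact ⟨fun ⟨x, hx, h1, h2⟩ => ⟨x, hx.1, h1, h2⟩,
    fun ⟨x, hx, h1, h2⟩ => ⟨x, ⟨hx, h2.trans_le h⟩, h1, h2⟩⟩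

/-- `C` assigns to every ordinal `β` below `Θ` a closed cofinal subset of `β`, coherently. -/
structure IsCoherentCSeq (Θ : Ordinal.{0}) (C : Ordinal.{0} → Set Ordinal.{0}) : Prop where
  subset : ∀ β < Θ, C β ⊆ Iio β
  cofinal : ∀ β < Θ, ∀ α < β, ∃ ξ ∈ C β, α ≤ ξ
  closed : ∀ β < Θ, ClosedIn (C β) β
  coherent : ∀ γ < Θ, ∀ β ∈ limitPts (C γ), β < γ → C β = C γ ∩ Iio β

/-- The extension of a sequence indexed by limit ordinals to all ordinals. -/
def extendSeq (C : Ordinal.{0} → Set Ordinal.{0}) (β : Ordinal.{0}) : Set Ordinal.{0} :=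
  { α | Order.IsSuccLimit β ∧ α ∈ C β ∨ α + 1 = β }

theorem extendSeq_of_isSuccLimit (C : Ordinal.{0} → Set Ordinal.{0}) {β : Ordinal.{0}}
    (h : Order.IsSuccLimit β) : extendSeq C β = C β := by
  ext α
  refine ⟨?_, fun hα => Or.inl ⟨h, hα⟩⟩
  rintro (hα | rfl)
  · exact hα.2
  · exact absurd (h.add_one_lt (lt_add_one α)) (lt_irrefl _)

theorem extendSeq_of_not_isSuccLimit (C : Ordinal.{0} → Set Ordinal.{0}) {β : Ordinal.{0}}
    (h : ¬ Order.IsSuccLimit β) : extendSeq C β = { α | α + 1 = β } := by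
  ext α
  exact ⟨fun hα => hα.resolve_left fun h' => h h'.1, Or.inr⟩

theorem IsSquareSeq.isCoherentCSeq {Θ : Ordinal.{0}} {C : Ordinal.{0} → Set Ordinal.{0}}
    (hC : IsSquareSeq Θ C) : IsCoherentCSeq Θ (extendSeq C) where
  subset β hβ := by
    by_cases h : Order.IsSuccLimit β
    · rw [extendSeq_of_isSuccLimit C h]
      exact (hC.unbounded β hβ h).1
    · rw [extendSeq_of_not_isSuccLimit C h]
      rintro α rfl
      exact lt_add_one α
  cofinal β hβ α hα := by
    by_cases h : Order.IsSuccLimit β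
    · rw [extendSeq_of_isSuccLimit C h]
      exact (hC.unbounded β hβ h).2 α hα
    · rw [extendSeq_of_not_isSuccLimit C h]
      rcases Ordinal.zero_or_succ_or_isSuccLimit β with rfl | ⟨c, rfl⟩ | h'
      · simp at hα
      · exact ⟨c, by simp, Order.lt_succ_iff.1 hα⟩
      · exact absurd h' h
  closed β hβ := by
    by_cases h : Order.IsSuccLimit β
    · rw [extendSeq_of_isSuccLimit C h]
      exact hC.closed β hβ h
    · rw [extendSeq_of_not_isSuccLimit C h]
      rintro S hS ⟨s, hs⟩ -
      have hs' : S = {s} := by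
        refine Set.eq_singleton_iff_unique_mem.2 ⟨hs, fun x hx => ?_⟩
        exact Order.add_one_inj.1 ((hS hx).trans (hS hs).symm)
      rw [hs', csSup_singleton]
      exact hS hs
  coherent γ hγ β hβ hlt := by
    by_cases h : Order.IsSuccLimit γ
    · rw [extendSeq_of_isSuccLimit C h] at hβ ⊢
      rw [extendSeq_of_isSuccLimit C (isSuccLimit_of_mem_limitPts hβ)]
      exact hC.coherent γ hγ h β hβ hlt
    · rw [extendSeq_of_not_isSuccLimit C h] at hβ
      obtain ⟨h0, hβ⟩ := mem_limitPts_iff.1 hβ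
      obtain ⟨x, hx, -, hxβ⟩ := hβ 0 (pos_iff_ne_zero.2 h0)
      exact absurd hlt (not_lt.2 (hx.ge.trans (Order.add_one_le_of_lt hxβ)))

/-- The first step of the walk from `β` to `α` along `C`. -/
def walkStep (C : Ordinal.{0} → Set Ordinal.{0}) (β α : Ordinal.{0}) : Ordinal.{0} :=
  sInf (C β ∩ Ici α)

/-- All ordinals visited by the walk from `β` to `α` along `C`, including `β` and `α`,
satisfy `p`. -/
inductive WalkIn (C : Ordinal.{0} → Set Ordinal.{0}) (p : Ordinal.{0} → Prop) :
    Ordinal.{0} → Ordinal.{0} → Prop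
  | refl {α : Ordinal.{0}} : p α → WalkIn C p α α
  | step {β α : Ordinal.{0}} : α < β → p β → WalkIn C p (walkStep C β α) α → WalkIn C p β α

section Walks

variable {Θ : Ordinal.{0}} {C : Ordinal.{0} → Set Ordinal.{0}} {p : Ordinal.{0} → Prop}

theorem walkIn_iff_of_lt {β α : Ordinal.{0}} (h : α < β) :
    WalkIn C p β α ↔ p β ∧ WalkIn C p (walkStep C β α) α := by
  refine ⟨fun hw => ?_, fun hw => WalkIn.step h hw.1 hw.2⟩
  cases hw with
  | refl => exact absurd h (lt_irrefl _)
  | step _ h1 h2 => exact ⟨h1, h2⟩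

theorem IsCoherentCSeq.walkStep_mem (hC : IsCoherentCSeq Θ C) {β α : Ordinal.{0}} (hβ : β < Θ)
    (hα : α < β) : walkStep C β α ∈ C β ∩ Ici α := by
  obtain ⟨ξ, hξ⟩ := hC.cofinal β hβ α hα
  exact csInf_mem (s := C β ∩ Ici α) ⟨ξ, hξ⟩

theorem IsCoherentCSeq.walkStep_lt (hC : IsCoherentCSeq Θ C) {β α : Ordinal.{0}} (hβ : β < Θ)
    (hα : α < β) : walkStep C β α < β :=
  hC.subset β hβ (hC.walkStep_mem hβ hα).1

theorem IsCoherentCSeq.walkStep_eq (hC : IsCoherentCSeq Θ C) {β α ξ : Ordinal.{0}} (hβ : β < Θ)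
    (hξ : ξ ∈ C β) (hα : α ≤ ξ) (h : ∀ x ∈ C β, x < ξ → x < α) : walkStep C β α = ξ := by
  have hm := hC.walkStep_mem hβ (hα.trans_lt (hC.subset β hβ hξ))
  refine le_antisymm (csInf_le' ⟨hξ, hα⟩) (not_lt.1 fun hlt => ?_)
  exact (h _ hm.1 hlt).not_ge hm.2

theorem IsCoherentCSeq.walkStep_eq_of_mem_limitPts (hC : IsCoherentCSeq Θ C)
    {β α ξ : Ordinal.{0}} (hβ : β < Θ) (hξ : ξ ∈ limitPts (C β)) (hξβ : ξ < β) (hα : α < ξ) :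
    walkStep C ξ α = walkStep C β α := by
  have hcoh := hC.coherent β hβ ξ hξ hξβ
  have hm := hC.walkStep_mem (hξβ.trans hβ) hα
  have hlt := hC.walkStep_lt (hξβ.trans hβ) hα
  rw [hcoh] at hm
  symm
  refine hC.walkStep_eq hβ hm.1.1 hm.2 fun x hx hxs => not_le.1 fun hαx => ?_
  refine (csInf_le' (s := C ξ ∩ Ici α) ⟨?_, hαx⟩).not_gt hxs
  rw [hcoh]
  exact ⟨hx, hxs.trans hlt⟩

variable {I : Type*} {l : Filter I} {q : I → Ordinal.{0} → Prop}

theorem IsCoherentCSeq.eventually_walkIn (hC : IsCoherentCSeq Θ C)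
    (hq : ∀ β, ∀ᶠ i in l, q i β) {β : Ordinal.{0}} (hβ : β < Θ) {α : Ordinal.{0}} (hα : α ≤ β) :
    ∀ᶠ i in l, WalkIn C (q i) β α := by
  induction β using WellFoundedLT.induction with
  | ind β ih =>
    rcases hα.eq_or_lt with rfl | hα
    · exact (hq α).mono fun i hi => WalkIn.refl hi
    · have hlt := hC.walkStep_lt hβ hα
      filter_upwards [hq β, ih _ hlt (hlt.trans hβ) (hC.walkStep_mem hβ hα).2] with i h1 h2
      exact WalkIn.step hα h1 h2

theorem IsCoherentCSeq.eventually_walkIn_iff (hC : IsCoherentCSeq Θ C)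
    (hq : ∀ β, ∀ᶠ i in l, q i β) {β : Ordinal.{0}} (hβ : β < Θ) {γ : Ordinal.{0}} (hγ : γ < β) :
    ∀ᶠ i in l, ∀ α < γ, (WalkIn C (q i) β α ↔ WalkIn C (q i) γ α) := by
  induction β using WellFoundedLT.induction generalizing γ with
  | ind β ih =>
    have key : ∀ ξ ∈ C β, ∀ᶠ i in l, ∀ α < ξ, (WalkIn C (q i) β α ↔ WalkIn C (q i) ξ α) := by
      intro ξ
      induction ξ using WellFoundedLT.induction with
      | ind ξ ihξ =>
        intro hξ
        have hξβ := hC.subset β hβ hξ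
        by_cases hlim : ξ ∈ limitPts (C β)
        · filter_upwards [hq β, hq ξ] with i h1 h2 α hα
          rw [walkIn_iff_of_lt hα, walkIn_iff_of_lt (hα.trans hξβ),
            hC.walkStep_eq_of_mem_limitPts hβ hlim hξβ hα]
          simp [h1, h2]
        · by_cases hne : (C β ∩ Iio ξ).Nonempty
          · have hbdd : BddAbove (C β ∩ Iio ξ) := ⟨ξ, fun x hx => hx.2.le⟩
            set ζ := sSup (C β ∩ Iio ξ) with hζ
            have hζξ : ζ < ξ :=
              lt_of_le_of_ne (csSup_le hne fun x hx => hx.2.le) fun h => hlim ⟨hne, h⟩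
            have hζC : ζ ∈ C β := hC.closed β hβ _ inter_subset_left hne (hζξ.trans hξβ)
            have hζβ := hζξ.trans hξβ
            filter_upwards [hq β, ihξ ζ hζξ hζC, ih ξ hξβ (hξβ.trans hβ) hζξ,
              hC.eventually_walkIn hq (hξβ.trans hβ) hζξ.le,
              hC.eventually_walkIn hq hβ hζβ.le] with i h1 h2 h3 h4 h5 α hα
            rcases lt_trichotomy α ζ with h | rfl | h
            · rw [h2 α h, h3 α h]
            · simp only [h4, h5]
            · rw [walkIn_iff_of_lt (hα.trans hξβ), hC.walkStep_eq hβ hξ hα.le fun x hx hxξ =>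
                (le_csSup hbdd ⟨hx, hxξ⟩).trans_lt h]
              simp [h1]
          · filter_upwards [hq β] with i h1 α hα
            rw [walkIn_iff_of_lt (hα.trans hξβ), hC.walkStep_eq hβ hξ hα.le fun x hx hxξ =>
                absurd ⟨x, hx, hxξ⟩ hne]
            simp [h1]
    have hm := hC.walkStep_mem hβ hγ
    rcases (mem_Ici.1 hm.2).eq_or_lt with h | h
    · exact key γ (h ▸ hm.1)
    · have hlt := hC.walkStep_lt hβ hγ
      filter_upwards [key _ hm.1, ih _ hlt (hlt.trans hβ) h] with i h1 h2 α hα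
      rw [h1 α (hα.trans h), h2 α hα]

theorem IsCoherentCSeq.exists_not_walkIn (hC : IsCoherentCSeq Θ C) {β : Ordinal.{0}}
    (hlim : Order.IsSuccLimit β) (hp : ¬ p β)
    (hcoh : ∀ γ < Θ, β ∈ limitPts (C γ) → ¬ p γ) {γ : Ordinal.{0}} (hγ : γ < Θ) (h : β ≤ γ) :
    ∃ ζ < β, ∀ α < β, ζ < α → ¬ WalkIn C p γ α := by
  have hpos : 0 < β := hlim.bot_lt
  induction γ using WellFoundedLT.induction with
  | ind γ ih =>
    rcases h.eq_or_lt with rfl | h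
    · exact ⟨0, hpos, fun α hα _ hw => hp ((walkIn_iff_of_lt hα).1 hw).1⟩
    by_cases hβ : β ∈ limitPts (C γ)
    · exact ⟨0, hpos, fun α hα _ hw => hcoh γ hγ hβ ((walkIn_iff_of_lt (hα.trans h)).1 hw).1⟩
    · obtain ⟨a, ha, hbd⟩ := exists_bound_of_notMem_limitPts hpos.ne' hβ
      have hm := hC.walkStep_mem hγ h
      have hlt := hC.walkStep_lt hγ h
      obtain ⟨ζ, hζ, hw⟩ := ih _ hlt (hlt.trans hγ) hm.2
      refine ⟨max a ζ, max_lt ha hζ, fun α hα hlt hwα => ?_⟩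
      have heq : walkStep C γ α = walkStep C γ β := by
        refine hC.walkStep_eq hγ hm.1 (hα.le.trans hm.2) fun x hx hxs => ?_
        have hxβ : x < β := not_le.1 fun hβx => (csInf_le' (s := C γ ∩ Ici β) ⟨hx, hβx⟩).not_gt hxs
        exact (hbd x hx hxβ).trans_lt ((le_max_left _ _).trans_lt hlt)
      rw [walkIn_iff_of_lt (hα.trans h), heq] at hwα
      exact hw α hα ((le_max_right _ _).trans_lt hlt) hwα.2

end Walks

/-! ### Stationary sets below a regular cardinal -/

/-- Every function from `κ` to `κ` has a nonzero closure point in `S`. -/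
def IsStat (κ : Cardinal.{0}) (S : Set Ordinal.{0}) : Prop :=
  ∀ f : Ordinal.{0} → Ordinal.{0}, (∀ α < κ.ord, f α < κ.ord) →
    ∃ β ∈ S, 0 < β ∧ β < κ.ord ∧ ∀ α < β, f α < β

section Stat

variable {κ : Cardinal.{0}} {S A B : Set Ordinal.{0}}

theorem IsStat.mono (hS : IsStat κ A) (h : A ⊆ B) : IsStat κ B := fun f hf =>
  let ⟨β, hβ, h'⟩ := hS f hf
  ⟨β, h hβ, h'⟩

theorem IsStat.exists_gt (hS : IsStat κ S) {b : Ordinal.{0}} (hb : b < κ.ord) :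
    ∃ β ∈ S, b < β ∧ β < κ.ord := by
  obtain ⟨β, hβ, h0, hβκ, h⟩ := hS (fun _ => b) fun _ _ => hb
  exact ⟨β, hβ, h 0 h0, hβκ⟩

theorem IsStat.exists_closed_gt (hS : IsStat κ S) {b : Ordinal.{0}} (hb : b < κ.ord)
    {f : Ordinal.{0} → Ordinal.{0}} (hf : ∀ α < κ.ord, f α < κ.ord) :
    ∃ β ∈ S, b < β ∧ β < κ.ord ∧ ∀ α < β, f α < β := by
  obtain ⟨β, hβ, h0, hβκ, h⟩ := hS (fun α => max b (f α)) fun α hα => max_lt hb (hf α hα)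
  exact ⟨β, hβ, (max_lt_iff.1 (h 0 h0)).1, hβκ, fun α hα => (max_lt_iff.1 (h α hα)).2⟩

theorem IsStat.inter_Ioi (hS : IsStat κ S) {b : Ordinal.{0}} (hb : b < κ.ord) :
    IsStat κ (S ∩ Ioi b) := by
  intro f hf
  obtain ⟨β, hβ, h1, h2, h3⟩ := hS.exists_closed_gt hb hf
  exact ⟨β, ⟨hβ, h1⟩, zero_le.trans_lt h1, h2, h3⟩

theorem IsStat.or (hS : IsStat κ (A ∪ B)) : IsStat κ A ∨ IsStat κ B := by
  by_contra! h
  simp only [IsStat] at h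
  push Not at h
  obtain ⟨⟨f, hf, hfA⟩, g, hg, hgB⟩ := h
  obtain ⟨β, hβ, h0, hβκ, h⟩ := hS (fun α => max (f α) (g α)) fun α hα => max_lt (hf α hα) (hg α hα)
  rcases hβ with hβ | hβ
  · obtain ⟨α, hα, h'⟩ := hfA β hβ h0 hβκ
    exact h'.not_gt (max_lt_iff.1 (h α hα)).1
  · obtain ⟨α, hα, h'⟩ := hgB β hβ h0 hβκ
    exact h'.not_gt (max_lt_iff.1 (h α hα)).2

/-- Fodor's lemma. -/
theorem IsStat.exists_fiber (hreg : κ.IsRegular) (hS : IsStat κ S)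
    {g : Ordinal.{0} → Ordinal.{0}} (hg : ∀ β ∈ S, 0 < β → β < κ.ord → g β < β) :
    ∃ v < κ.ord, IsStat κ { β | β ∈ S ∧ g β = v } := by
  by_contra! hcon
  have hex : ∀ v, ∃ f : Ordinal.{0} → Ordinal.{0}, v < κ.ord → (∀ α < κ.ord, f α < κ.ord) ∧
      ∀ β ∈ S, g β = v → 0 < β → β < κ.ord → ∃ α < β, β ≤ f α := by
    intro v
    by_cases hv : v < κ.ord
    · have h := hcon v hv
      simp only [IsStat] at h
      push Not at h
      obtain ⟨f, hf, h⟩ := h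
      exact ⟨f, fun _ => ⟨hf, fun β hβ hgβ => h β ⟨hβ, hgβ⟩⟩⟩
    · exact ⟨id, fun h => absurd h hv⟩
  choose f hf using hex
  have hF : ∀ α, ∃ b, α < κ.ord → b < κ.ord ∧ ∀ v < α + 1, ∀ a < α + 1, f v a ≤ b := by
    intro α
    by_cases hα : α < κ.ord
    · have hα1 := IsRegular.add_one_lt hreg hα
      have h1 : ∀ v, ∃ b, v < α + 1 → b < κ.ord ∧ ∀ a < α + 1, f v a ≤ b := by
        intro v
        by_cases hv : v < α + 1
        · obtain ⟨b, hb⟩ := IsRegular.exists_bound_Iio hreg hα1 (f v) fun a ha =>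
            (hf v (hv.trans hα1)).1 a (ha.trans hα1)
          exact ⟨b, fun _ => hb⟩
        · exact ⟨0, fun h => absurd h hv⟩
      choose b hb using h1
      obtain ⟨c, hc, h⟩ := IsRegular.exists_bound_Iio hreg hα1 b fun v hv => (hb v hv).1
      exact ⟨c, fun _ => ⟨hc, fun v hv a ha => ((hb v hv).2 a ha).trans (h v hv)⟩⟩
    · exact ⟨0, fun h => absurd h hα⟩
  choose F hF using hF
  obtain ⟨β, hβ, h0, hβκ, h⟩ := hS (fun α => F α + 1) fun α hα =>
    IsRegular.add_one_lt hreg (hF α hα).1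
  have hgβ := hg β hβ h0 hβκ
  obtain ⟨α, hα, hle⟩ := (hf _ (hgβ.trans hβκ)).2 β hβ rfl h0 hβκ
  have hm : max (g β) α < β := max_lt hgβ hα
  have h1 := (hF _ (hm.trans hβκ)).2 (g β) (Order.lt_add_one_iff.2 (le_max_left _ _)) α
    (Order.lt_add_one_iff.2 (le_max_right _ _))
  exact (hle.trans h1).not_gt ((lt_add_one _).trans (h _ hm))

end Stat

theorem IsNormalUltrafilter.eventually_le (hU : IsNormalUltrafilter δ U) {c : Ordinal.{0}}
    (hc : c < δ.ord) : ∀ᶠ i : Idx δ in U, c ≤ i.1 := by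
  have hcard : #(Shrink.{0} (Iio c)) < δ := by
    rw [← Cardinal.lift_lt.{0, 1}, Cardinal.lift_mk_shrink'', Cardinal.mk_Iio_ordinal]
    exact Cardinal.lift_lt.2 (Cardinal.lt_ord.1 hc)
  have h := hU.complete (Shrink.{0} (Iio c))
    (fun j => {⟨((equivShrink (Iio c)).symm j).1, (((equivShrink (Iio c)).symm j).2).trans hc⟩}ᶜ)
    hcard fun j => Ultrafilter.compl_mem_iff_notMem.2 (hU.nonprincipal _)
  filter_upwards [h] with i hi
  by_contra! hlt
  refine mem_iInter.1 hi (equivShrink (Iio c) ⟨i.1, hlt⟩) ?_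
  simp

theorem IsNormalUltrafilter.exists_bound (hU : IsNormalUltrafilter δ U) {ι : Type} (hι : #ι < δ)
    (m : ι → Ordinal.{0}) (hm : ∀ j, m j < δ.ord) : ∃ b < δ.ord, ∀ j, m j ≤ b := by
  have h := hU.complete ι (fun j => { i | m j ≤ i.1 }) hι fun j => hU.eventually_le (hm j)
  obtain ⟨i, hi⟩ := U.nonempty_of_mem h
  exact ⟨i.1, i.2, fun j => mem_iInter.1 hi j⟩

/-- The limit ordinals of cofinality at least `δ`. -/
def cofAtLeast (δ : Cardinal.{0}) : Set Ordinal.{0} :=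
  { β | ∀ ι : Type, #ι < δ → ∀ f : ι → Ordinal.{0}, (∀ j, f j < β) → ∃ b < β, ∀ j, f j < b }

theorem isSuccLimit_of_mem_cofAtLeast (hδ : ℵ₀ < δ) {β : Ordinal.{0}} (hβ : β ∈ cofAtLeast δ) :
    Order.IsSuccLimit β := by
  have h1 : (1 : Cardinal.{0}) < δ := Cardinal.one_lt_aleph0.trans hδ
  refine ⟨?_, Order.isSuccPrelimit_of_succ_lt fun a ha => ?_⟩
  · obtain ⟨b, hb, -⟩ := hβ Empty (by simpa using h1.pos) (fun j => j.elim) fun j => j.elim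
    simpa using (zero_le.trans_lt hb).ne'
  · obtain ⟨b, hb, hab⟩ := hβ Unit (by simpa using h1) (fun _ => a) fun _ => ha
    exact (Order.succ_le_of_lt (hab ())).trans_lt hb

theorem isStat_cofAtLeast (hU : IsNormalUltrafilter δ U) {κ : Cardinal.{0}} (hκ : δ < κ)
    (hreg : κ.IsRegular) : IsStat κ (cofAtLeast δ) := by
  intro f hf
  have hh : ∀ α, ∃ b, α < b ∧ (α < κ.ord → b < κ.ord ∧ ∀ a ≤ α, f a < b) := by
    intro α
    by_cases hα : α < κ.ord
    · have hα1 := IsRegular.add_one_lt hreg hα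
      obtain ⟨b, hb, h⟩ := IsRegular.exists_bound_Iio hreg hα1 f fun a ha => hf a (ha.trans hα1)
      exact ⟨max α b + 1, Order.lt_add_one_iff.2 (le_max_left _ _), fun _ =>
        ⟨IsRegular.add_one_lt hreg (max_lt hα hb), fun a ha => Order.lt_add_one_iff.2
          ((h a (Order.lt_add_one_iff.2 ha)).trans (le_max_right _ _))⟩⟩
    · exact ⟨α + 1, lt_add_one α, fun h => absurd h hα⟩
  choose h hlt hh using hh
  let s : Ordinal.{0} → Ordinal.{0} :=
    WellFoundedLT.fix fun n ih => ⨆ m : Iio n, h (ih m.1 m.2)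
  have hs : ∀ n, s n = ⨆ m : Iio n, h (s m.1) := fun n => WellFoundedLT.fix_eq _ n
  have hle : ∀ {m n}, m < n → h (s m) ≤ s n := by
    intro m n hmn
    rw [hs n]
    exact le_ciSup (f := fun m : Iio n => h (s m.1))
      (Ordinal.bddAbove_of_small (s := range _)) ⟨m, hmn⟩
  have hsκ : ∀ n < κ.ord, s n < κ.ord := by
    intro n
    induction n using WellFoundedLT.induction with
    | ind n ih =>
      intro hn
      obtain ⟨b, hb, hsb⟩ := IsRegular.exists_bound_Iio hreg hn (fun m => h (s m))
        fun m hm => (hh _ (ih m hm (hm.trans hn))).1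
      rw [hs n]
      exact (ciSup_le' fun m : Iio n => hsb m.1 m.2).trans_lt hb
  have hδκ : δ.ord < κ.ord := Cardinal.ord_lt_ord.2 hκ
  have hδlim := Cardinal.isSuccLimit_ord hU.uncountable.le
  have hmem : ∀ {x}, x < s δ.ord → ∃ m < δ.ord, x < h (s m) := by
    intro x hx
    rw [hs δ.ord, lt_ciSup_iff' (Ordinal.bddAbove_of_small (s := range _))] at hx
    obtain ⟨m, hm⟩ := hx
    exact ⟨m.1, m.2, hm⟩
  have hδ0 : 0 < δ.ord := hδlim.bot_lt
  refine ⟨s δ.ord, ?_, zero_le.trans_lt ((hlt _).trans_le (hle hδ0)), hsκ _ hδκ, ?_⟩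
  · intro ι hι g hg
    choose m hm hgm using fun j => hmem (hg j)
    obtain ⟨b, hb, hmb⟩ := hU.exists_bound hι m hm
    have hb1 := hδlim.add_one_lt hb
    exact ⟨s (b + 1), (hlt _).trans_le (hle hb1), fun j =>
      (hgm j).trans_le (hle (Order.lt_add_one_iff.2 (hmb j)))⟩
  · intro α hα
    obtain ⟨m, hm, hαm⟩ := hmem hα
    have hm1 := hδlim.add_one_lt hm
    exact ((hh _ (hsκ _ (hm1.trans hδκ))).2 α
      (hαm.le.trans (hle (lt_add_one m)))).trans_le (hle hm1)

/-- If the indices of a coherent sequence carry labels below `δ` that are constant along the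
sequence and stationarily often arbitrarily large, then the ordinals walked to through small labels
represent a fresh club. -/
theorem exists_fresh_of_labeling (hU : IsNormalUltrafilter δ U) {κ : Cardinal.{0}} (hκ : δ < κ)
    (hreg : κ.IsRegular) {C : Ordinal.{0} → Set Ordinal.{0}} (hC : IsCoherentCSeq κ.ord C)
    (ℓ : Ordinal.{0} → Ordinal.{0}) (hℓ : ∀ β, ℓ β < δ.ord) {ε : Ordinal.{0}}
    (hcoh : ∀ γ < κ.ord, ∀ β ∈ limitPts (C γ), ε ≤ β → ℓ γ = ℓ β)
    (hstat : ∀ η < δ.ord, IsStat κ { β | Order.IsSuccLimit β ∧ ε ≤ β ∧ η < ℓ β }) :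
    ∃ A : Set Ordinal.{0}, ClosedIn A (jU hU κ.ord) ∧ UnbSub A (jU hU κ.ord) ∧
      Fresh hU A := by
  let q : Idx δ → Ordinal.{0} → Prop := fun i β => ℓ β ≤ i.1
  have hq : ∀ β, ∀ᶠ i in U, q i β := fun β => hU.eventually_le (hℓ β)
  let Y : Ordinal.{0} → Idx δ → Set Ordinal.{0} := fun β i =>
    { α | α < β ∧ ((∀ c, c + 1 ≠ α) ∨ ∃ c, c + 1 = α ∧ WalkIn C (q i) β c) }
  have hY : ∀ β i c, c + 1 < β → (c + 1 ∈ Y β i ↔ WalkIn C (q i) β c) := by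
    intro β i c hc
    constructor
    · rintro ⟨-, h | ⟨d, hd, h⟩⟩
      · exact absurd rfl (h c)
      · rwa [Order.add_one_inj.1 hd] at h
    · exact fun h => ⟨hc, Or.inr ⟨c, rfl, h⟩⟩
  refine exists_fresh_of_coherent hU hκ hreg Y (fun β i α h => h.1) ?_
    (fun β i α hα h => ⟨hα, Or.inl h⟩) ?_
  · intro β hβ γ hγ
    filter_upwards [hC.eventually_walkIn_iff hq hβ hγ] with i hi
    ext α
    constructor
    · rintro ⟨⟨-, h | ⟨c, rfl, h⟩⟩, hα⟩
      · exact ⟨hα, Or.inl h⟩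
      · exact ⟨hα, Or.inr ⟨c, rfl, (hi c ((lt_add_one c).trans hα)).1 h⟩⟩
    · rintro ⟨hα, h | ⟨c, rfl, h⟩⟩
      · exact ⟨⟨hα.trans hγ, Or.inl h⟩, hα⟩
      · exact ⟨⟨hα.trans hγ, Or.inr ⟨c, rfl, (hi c ((lt_add_one c).trans hα)).2 h⟩⟩, hα⟩
  rintro ⟨F, hF⟩
  let P : Ordinal.{0} → Idx δ → Prop := fun β i =>
    ∀ α < β, (α + 1 ∈ F i ↔ WalkIn C (q i) β α)
  have hP : ∀ β < κ.ord, ∀ᶠ i in U, P β i := by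
    intro β hβ
    have hβ1 := IsRegular.add_one_lt hreg hβ
    have hβ2 := IsRegular.add_one_lt hreg hβ1
    filter_upwards [hF _ hβ2, hC.eventually_walkIn_iff hq hβ2
      ((lt_add_one β).trans (lt_add_one _))] with i h1 h2 α hα
    have hα1 : α + 1 < β + 1 + 1 :=
      (Order.add_one_le_of_lt hα).trans_lt ((lt_add_one β).trans (lt_add_one _))
    rw [← h2 α hα, ← hY _ i α hα1, ← h1]
    exact ⟨fun h => ⟨h, hα1⟩, fun h => h.1⟩
  obtain ⟨i, hi1, hi2⟩ : ∃ i : Idx δ, (∀ b < κ.ord, ∃ β < κ.ord, b < β ∧ P β i) ∧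
      ∀ b < κ.ord, ∃ α < κ.ord, b < α ∧ α + 1 ∈ F i := by
    by_contra! hbad
    have hb : ∀ i, ∃ b < κ.ord,
        (∀ β < κ.ord, P β i → β ≤ b) ∨ ∀ α < κ.ord, α + 1 ∈ F i → α ≤ b := by
      intro i
      by_cases h : ∀ b < κ.ord, ∃ β < κ.ord, b < β ∧ P β i
      · obtain ⟨b, hb, hbi⟩ := hbad i h
        exact ⟨b, hb, Or.inr fun α hα hαF => not_lt.1 fun hlt => hbi α hα hlt hαF⟩
      · push Not at h
        obtain ⟨b, hb, hbi⟩ := h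
        exact ⟨b, hb, Or.inl fun β hβ hβP => not_lt.1 fun hlt => hbi β hβ hlt hβP⟩
    choose b hb hbi using hb
    obtain ⟨c, hc, hbc⟩ := IsRegular.exists_bound_Idx hreg hκ b hb
    have hc1 := IsRegular.add_one_lt hreg hc
    have hc2 := IsRegular.add_one_lt hreg hc1
    obtain ⟨i, h1, h2⟩ := ((hP _ hc2).and
      (hC.eventually_walkIn hq hc2 (lt_add_one (c + 1)).le)).exists
    rcases hbi i with h | h
    · exact ((h _ hc2 h1).trans (hbc i)).not_gt ((lt_add_one c).trans (lt_add_one _))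
    · exact ((h _ hc1 ((h1 _ (lt_add_one _)).2 h2)).trans (hbc i)).not_gt (lt_add_one c)
  have hf : ∀ b, ∃ α, b < κ.ord → α < κ.ord ∧ b < α ∧ α + 1 ∈ F i := by
    intro b
    by_cases hb : b < κ.ord
    · obtain ⟨α, h⟩ := hi2 b hb
      exact ⟨α, fun _ => h⟩
    · exact ⟨0, fun h => absurd h hb⟩
  choose f hf using hf
  obtain ⟨β, ⟨hlim, hεβ, hlt⟩, -, hβκ, hβf⟩ := hstat i.1 i.2 f fun α hα => (hf α hα).1
  obtain ⟨β', hβ', hββ', hPβ'⟩ := hi1 β hβκ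
  obtain ⟨ζ, hζ, hw⟩ := hC.exists_not_walkIn (p := q i) hlim hlt.not_ge
    (fun γ hγ hβγ hle => hlt.not_ge ((hcoh γ hγ β hβγ hεβ).ge.trans hle)) hβ' hββ'.le
  have hfζ := hf ζ (hζ.trans hβκ)
  exact hw _ (hβf ζ hζ) hfζ.2.1 ((hPβ' _ ((hβf ζ hζ).trans hββ')).1 hfζ.2.2)

/-! ### Stationary branches of the tree of limit points -/

/-- The least limit point of `C γ` that is at least `ε`. -/
def nextLimitPt (C : Ordinal.{0} → Set Ordinal.{0}) (ε γ : Ordinal.{0}) : Ordinal.{0} :=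
  sInf (limitPts (C γ) ∩ Ici ε)

section Tree

variable {Θ : Ordinal.{0}} {C : Ordinal.{0} → Set Ordinal.{0}}

theorem IsCoherentCSeq.self_mem_limitPts (hC : IsCoherentCSeq Θ C) {γ : Ordinal.{0}} (hγ : γ < Θ)
    (hlim : Order.IsSuccLimit γ) : γ ∈ limitPts (C γ) := by
  refine mem_limitPts_iff.2 ⟨hlim.bot_lt.ne', fun a ha => ?_⟩
  obtain ⟨ξ, hξ, hle⟩ := hC.cofinal γ hγ (a + 1) (hlim.add_one_lt ha)
  exact ⟨ξ, hξ, (lt_add_one a).trans_le hle, hC.subset γ hγ hξ⟩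

theorem IsCoherentCSeq.le_of_mem_limitPts (hC : IsCoherentCSeq Θ C) {β γ : Ordinal.{0}}
    (hγ : γ < Θ) (hβ : β ∈ limitPts (C γ)) : β ≤ γ := by
  by_contra! hlt
  obtain ⟨x, hx, h1, -⟩ := (mem_limitPts_iff.1 hβ).2 γ hlt
  exact h1.not_gt (hC.subset γ hγ hx)

theorem IsCoherentCSeq.mem_limitPts_iff_of_le (hC : IsCoherentCSeq Θ C) {β γ ξ : Ordinal.{0}}
    (hγ : γ < Θ) (hβ : β ∈ limitPts (C γ)) (hξ : ξ ≤ β) :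
    ξ ∈ limitPts (C β) ↔ ξ ∈ limitPts (C γ) := by
  rcases (hC.le_of_mem_limitPts hγ hβ).eq_or_lt with rfl | h
  · rfl
  · rw [hC.coherent γ hγ β hβ h, limitPts_inter_Iio hξ]

theorem nextLimitPt_mem {ε β γ : Ordinal.{0}} (hβ : β ∈ limitPts (C γ)) (hε : ε ≤ β) :
    nextLimitPt C ε γ ∈ limitPts (C γ) ∩ Ici ε :=
  csInf_mem (s := limitPts (C γ) ∩ Ici ε) ⟨β, hβ, hε⟩

theorem nextLimitPt_le {ε β γ : Ordinal.{0}} (hβ : β ∈ limitPts (C γ)) (hε : ε ≤ β) :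
    nextLimitPt C ε γ ≤ β :=
  csInf_le' (s := limitPts (C γ) ∩ Ici ε) ⟨hβ, hε⟩

theorem IsCoherentCSeq.nextLimitPt_eq (hC : IsCoherentCSeq Θ C) {ε β γ : Ordinal.{0}}
    (hγ : γ < Θ) (hβ : β ∈ limitPts (C γ)) (hε : ε ≤ β) :
    nextLimitPt C ε γ = nextLimitPt C ε β := by
  have hle := nextLimitPt_le hβ hε
  have hm := nextLimitPt_mem hβ hε
  have hββ := (hC.mem_limitPts_iff_of_le hγ hβ le_rfl).2 hβ
  have hm' := nextLimitPt_mem hββ hε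
  exact le_antisymm
    (nextLimitPt_le ((hC.mem_limitPts_iff_of_le hγ hβ (nextLimitPt_le hββ hε)).1 hm'.1) hm'.2)
    (nextLimitPt_le ((hC.mem_limitPts_iff_of_le hγ hβ hle).2 hm.1) hm.2)

theorem IsCoherentCSeq.nextLimitPt_lt (hC : IsCoherentCSeq Θ C) (hδ : ℵ₀ < δ) {ε γ : Ordinal.{0}}
    (hγ : γ < Θ) (hγδ : γ ∈ cofAtLeast δ) (hε : ε < γ) : nextLimitPt C ε γ < γ := by
  have hlim := isSuccLimit_of_mem_cofAtLeast hδ hγδ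
  have hnext : ∀ a : Iio γ, ∃ ξ : Iio γ, ξ.1 ∈ C γ ∧ a.1 < ξ.1 := by
    rintro ⟨a, ha⟩
    obtain ⟨ξ, hξ, hle⟩ := hC.cofinal γ hγ (a + 1) (hlim.add_one_lt ha)
    exact ⟨⟨ξ, hC.subset γ hγ hξ⟩, hξ, (lt_add_one a).trans_le hle⟩
  choose s hs hlt using hnext
  let x : ℕ → Iio γ := fun n => s^[n] ⟨ε, hε⟩
  have hx : ∀ n, x (n + 1) = s (x n) := fun n => Function.iterate_succ_apply' s n _
  obtain ⟨b, hb, hxb⟩ := hγδ ℕ (by simpa using hδ) (fun n => (x n).1) fun n => (x n).2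
  have hbdd : BddAbove (range fun n => (x n).1) := ⟨b, by rintro _ ⟨n, rfl⟩; exact (hxb n).le⟩
  have hle : ∀ n, (x n).1 ≤ ⨆ n, (x n).1 := fun n => le_ciSup hbdd n
  have hstep : ∀ n, (x n).1 < (x (n + 1)).1 := fun n => hx n ▸ hlt (x n)
  have hεle : ε ≤ ⨆ n, (x n).1 := hle 0
  refine (nextLimitPt_le (β := ⨆ n, (x n).1) (mem_limitPts_iff.2 ⟨?_, fun a ha => ?_⟩)
    hεle).trans_lt ((ciSup_le' fun n => (hxb n).le).trans_lt hb)
  · exact (zero_le.trans_lt ((hstep 0).trans_le (hle 1))).ne'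
  · obtain ⟨n, hn⟩ := (lt_ciSup_iff' hbdd).1 ha
    exact ⟨(x (n + 1)).1, hx n ▸ hs (x n), hn.trans (hstep n), (hstep _).trans_le (hle (n + 2))⟩

/-- An unbounded set of indices that are limit points of one another yields a thread. -/
theorem IsCoherentCSeq.exists_thread (hC : IsCoherentCSeq Θ C) {S : Set Ordinal.{0}}
    (hunb : ∀ b < Θ, ∃ β ∈ S, b < β ∧ β < Θ)
    (hS : ∀ β ∈ S, ∀ β' ∈ S, β' < Θ → β < β' → β ∈ limitPts (C β')) :
    ∃ D : Set Ordinal.{0}, ClosedIn D Θ ∧ UnbSub D Θ ∧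
      ∀ γ ∈ limitPts D, γ < Θ → D ∩ Iio γ = C γ := by
  let D : Set Ordinal.{0} := { α | ∃ β ∈ S, β < Θ ∧ α ∈ C β }
  have hD : ∀ β ∈ S, β < Θ → D ∩ Iio β = C β := by
    intro β hβ hβΘ
    ext α
    constructor
    · rintro ⟨⟨β', hβ', hβ'Θ, hα⟩, hlt⟩
      rcases lt_trichotomy β' β with h | rfl | h
      · rw [hC.coherent β hβΘ β' (hS β' hβ' β hβ hβΘ h) h] at hα
        exact hα.1
      · exact hα
      · rw [hC.coherent β' hβ'Θ β (hS β hβ β' hβ' hβ'Θ h) h]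
        exact ⟨hα, hlt⟩
    · exact fun h => ⟨⟨β, hβ, hβΘ, h⟩, hC.subset β hβΘ h⟩
  have hsub : D ⊆ Iio Θ := by
    rintro α ⟨β, -, hβΘ, hα⟩
    exact (hC.subset β hβΘ hα).trans hβΘ
  refine ⟨D, ?_, ⟨hsub, ?_⟩, ?_⟩
  · intro T hT hne hlt
    obtain ⟨β, hβ, hTβ, hβΘ⟩ := hunb _ hlt
    have hTC : T ⊆ C β := by
      rw [← hD β hβ hβΘ]
      exact fun t ht => ⟨hT ht, (le_csSup ⟨Θ, fun u hu => (hsub (hT hu)).le⟩ ht).trans_lt hTβ⟩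
    exact ⟨β, hβ, hβΘ, hC.closed β hβΘ T hTC hne hTβ⟩
  · intro b hb
    obtain ⟨β, hβ, hbβ, hβΘ⟩ := hunb b hb
    obtain ⟨ξ, hξ, h⟩ := hC.cofinal β hβΘ b hbβ
    exact ⟨ξ, ⟨β, hβ, hβΘ, hξ⟩, h⟩
  · intro γ hγ hγΘ
    obtain ⟨β, hβ, hγβ, hβΘ⟩ := hunb γ hγΘ
    have hγC : γ ∈ limitPts (C β) := by
      rwa [← hD β hβ hβΘ, limitPts_inter_Iio hγβ.le]
    rw [hC.coherent β hβΘ γ hγC hγβ, ← hD β hβ hβΘ, inter_assoc,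
      Iio_inter_Iio, min_eq_right hγβ.le]

end Tree

/-- The ordinals that are the least limit point above `ε` of `C γ` for stationarily many `γ < κ` of
cofinality at least `δ`. -/
def statPts (δ κ : Cardinal.{0}) (C : Ordinal.{0} → Set Ordinal.{0}) (ε : Ordinal.{0}) :
    Set Ordinal.{0} :=
  { v | IsStat κ { γ | γ ∈ cofAtLeast δ ∧ γ < κ.ord ∧ ε ≤ γ ∧ nextLimitPt C ε γ = v } }

theorem exists_fresh_of_le_mk_statPts (hU : IsNormalUltrafilter δ U) {κ : Cardinal.{0}}
    (hκ : δ < κ) (hreg : κ.IsRegular) {C : Ordinal.{0} → Set Ordinal.{0}}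
    (hC : IsCoherentCSeq κ.ord C) {ε : Ordinal.{0}}
    (hε : Cardinal.lift.{1} δ ≤ #(statPts δ κ C ε)) :
    ∃ A : Set Ordinal.{0}, ClosedIn A (jU hU κ.ord) ∧ UnbSub A (jU hU κ.ord) ∧
      Fresh hU A := by
  classical
  rw [← mk_Idx] at hε
  obtain ⟨e⟩ := hε
  let ℓ : Ordinal.{0} → Ordinal.{0} := fun β =>
    if h : ∃ i, (e i).1 = nextLimitPt C ε β then h.choose.1 else 0
  have hδlim := Cardinal.isSuccLimit_ord hU.uncountable.le
  refine exists_fresh_of_labeling hU hκ hreg hC ℓ (fun β => ?_) (ε := ε) ?_ ?_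
  · by_cases h : ∃ i, (e i).1 = nextLimitPt C ε β
    · simp only [ℓ, dif_pos h]
      exact h.choose.2
    · simp only [ℓ, dif_neg h]
      exact hδlim.bot_lt
  · intro γ hγ β hβ hεβ
    simp only [ℓ, hC.nextLimitPt_eq hγ hβ hεβ]
  · intro η hη
    let i : Idx δ := ⟨η + 1, hδlim.add_one_lt hη⟩
    refine IsStat.mono (e i).2 ?_
    rintro γ ⟨hγ, -, hεγ, hv⟩
    refine ⟨isSuccLimit_of_mem_cofAtLeast hU.uncountable hγ, hεγ, ?_⟩
    have h : ∃ i, (e i).1 = nextLimitPt C ε γ := ⟨i, hv.symm⟩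
    have hi : h.choose = i := e.injective (Subtype.ext (h.choose_spec.trans hv))
    simp only [ℓ, dif_pos h, hi, i]
    exact lt_add_one η

section StatPts

variable {κ : Cardinal.{0}} {C : Ordinal.{0} → Set Ordinal.{0}}

theorem exists_of_mem_statPts (hδ : ℵ₀ < δ) (hreg : κ.IsRegular) (hC : IsCoherentCSeq κ.ord C)
    {ε v : Ordinal.{0}} (hv : v ∈ statPts δ κ C ε) :
    ∃ γ < κ.ord, v ∈ limitPts (C γ) ∧ ε ≤ v ∧ nextLimitPt C ε γ = v := by
  obtain ⟨γ, ⟨hγ, -, hεγ, rfl⟩, -, hγκ⟩ := hv.exists_gt hreg.ord_pos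
  have h := nextLimitPt_mem (hC.self_mem_limitPts hγκ (isSuccLimit_of_mem_cofAtLeast hδ hγ)) hεγ
  exact ⟨γ, hγκ, h.1, h.2, rfl⟩

theorem exists_statPts_subset (hδ : ℵ₀ < δ) (hreg : κ.IsRegular)
    (hC : IsCoherentCSeq κ.ord C) {β : Ordinal.{0}} (hβ : β ∈ cofAtLeast δ)
    (hcard : #(statPts δ κ C β) < Cardinal.lift.{1} δ) :
    ∃ ε < β, ∀ v ∈ statPts δ κ C β, v ≠ β → v ∈ statPts δ κ C ε := by
  have hlim := isSuccLimit_of_mem_cofAtLeast hδ hβ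
  have key : ∀ v ∈ statPts δ κ C β, ∃ a < β, v ≠ β → ∀ ξ ∈ limitPts (C v), ξ < β → ξ ≤ a := by
    intro v hv
    by_cases hvβ : v = β
    · exact ⟨0, hlim.bot_lt, fun h => absurd hvβ h⟩
    obtain ⟨γ, hγ, hvγ, hβv, hnext⟩ := exists_of_mem_statPts hδ hreg hC hv
    have hβv' := lt_of_le_of_ne hβv (Ne.symm hvβ)
    obtain ⟨a, ha, hbd⟩ := exists_bound_of_notMem_limitPts hlim.bot_lt.ne'
      fun h : β ∈ limitPts (C v) => hβv'.not_ge (hnext ▸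
        nextLimitPt_le ((hC.mem_limitPts_iff_of_le hγ hvγ hβv).1 h) le_rfl)
    refine ⟨a, ha, fun _ ξ hξ hξβ => not_lt.1 fun hlt => ?_⟩
    obtain ⟨x, hx, h1, h2⟩ := (mem_limitPts_iff.1 hξ).2 a hlt
    exact (hbd x hx (h2.trans hξβ)).not_gt h1
  obtain ⟨c, hc, hcV⟩ := Cardinal.lt_lift_iff.1 hcard
  induction c using Cardinal.inductionOn with | _ ι
  obtain ⟨E⟩ := Cardinal.lift_mk_eq'.1 (hcV.trans (Cardinal.lift_uzero _).symm)
  choose! a ha hbd using key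
  obtain ⟨ε, hε, haε⟩ := hβ ι hc (fun j => a (E j)) fun j => ha _ (E j).2
  refine ⟨ε, hε, fun v hv hvβ => IsStat.mono hv ?_⟩
  rintro γ ⟨hγ, hγκ, hβγ, hnext⟩
  refine ⟨hγ, hγκ, hε.le.trans hβγ, ?_⟩
  have hm := nextLimitPt_mem (hC.self_mem_limitPts hγκ (isSuccLimit_of_mem_cofAtLeast hδ hγ)) hβγ
  rw [hnext] at hm
  have hεv : ε ≤ v := hε.le.trans hm.2
  have hle := nextLimitPt_le hm.1 hεv
  have hm' := nextLimitPt_mem hm.1 hεv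
  refine le_antisymm hle ?_
  rw [← hnext]
  refine nextLimitPt_le hm'.1 (not_lt.1 fun hlt => ?_)
  have h1 := hbd v hv hvβ _ ((hC.mem_limitPts_iff_of_le hγκ hm.1 hle).2 hm'.1) hlt
  have h2 := haε (E.symm ⟨v, hv⟩)
  rw [E.apply_symm_apply] at h2
  exact (h1.trans_lt h2).not_ge hm'.2

theorem not_isStat_compl_statPts (hδ : ℵ₀ < δ) (hreg : κ.IsRegular)
    (hC : IsCoherentCSeq κ.ord C) : ¬ IsStat κ { γ | γ ∈ cofAtLeast δ ∧ γ < κ.ord ∧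
      ∃ ε < γ, nextLimitPt C ε γ ∉ statPts δ κ C ε } := by
  intro hN
  have hε : ∀ γ, ∃ ε, (∃ ε < γ, nextLimitPt C ε γ ∉ statPts δ κ C ε) →
      ε < γ ∧ nextLimitPt C ε γ ∉ statPts δ κ C ε := by
    intro γ
    by_cases h : ∃ ε < γ, nextLimitPt C ε γ ∉ statPts δ κ C ε
    · obtain ⟨ε, hε⟩ := h
      exact ⟨ε, fun _ => hε⟩
    · exact ⟨0, fun h' => absurd h' h⟩
  choose e he using hε
  obtain ⟨ε, -, h1⟩ := hN.exists_fiber hreg (g := e) fun γ hγ _ _ => (he γ hγ.2.2).1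
  obtain ⟨v, -, h2⟩ := h1.exists_fiber hreg (g := nextLimitPt C ε) fun γ hγ _ hγκ =>
    hC.nextLimitPt_lt hδ hγκ hγ.1.1 (hγ.2 ▸ (he γ hγ.1.2.2).1)
  obtain ⟨γ, ⟨⟨hγ, rfl⟩, rfl⟩, -⟩ := h2.exists_gt hreg.ord_pos
  refine (he γ hγ.2.2).2 (h2.mono ?_)
  rintro γ' ⟨⟨hγ', heq⟩, hv⟩
  exact ⟨hγ'.1, hγ'.2.1, heq ▸ (he γ' hγ'.2.2).1.le, hv⟩

theorem exists_thread_of_mk_statPts_lt (hU : IsNormalUltrafilter δ U) (hκ : δ < κ)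
    (hreg : κ.IsRegular) (hC : IsCoherentCSeq κ.ord C)
    (hcard : ∀ ε, #(statPts δ κ C ε) < Cardinal.lift.{1} δ) :
    ∃ D : Set Ordinal.{0}, ClosedIn D κ.ord ∧ UnbSub D κ.ord ∧
      ∀ γ ∈ limitPts D, γ < κ.ord → D ∩ Iio γ = C γ := by
  have hδ := hU.uncountable
  have he : ∀ β, ∃ ε, β ∈ cofAtLeast δ →
      ε < β ∧ ∀ v ∈ statPts δ κ C β, v ≠ β → v ∈ statPts δ κ C ε := by
    intro β
    by_cases hβ : β ∈ cofAtLeast δ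
    · obtain ⟨ε, h⟩ := exists_statPts_subset hδ hreg hC hβ (hcard β)
      exact ⟨ε, fun _ => h⟩
    · exact ⟨0, fun h => absurd h hβ⟩
  choose e he using he
  obtain ⟨ε, -, hS⟩ := (isStat_cofAtLeast hU hκ hreg).exists_fiber hreg (g := e)
    fun β hβ _ _ => (he β hβ).1
  obtain ⟨b, hb, hεb⟩ := IsRegular.exists_bound hreg
    ((hcard ε).trans (Cardinal.lift_lt.2 hκ)) (fun v : statPts δ κ C ε => v.1) fun v => by
      obtain ⟨γ, hγ, hv, -⟩ := exists_of_mem_statPts hδ hreg hC v.2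
      exact (hC.le_of_mem_limitPts hγ hv).trans_lt hγ
  let N : Set Ordinal.{0} := { γ | γ ∈ cofAtLeast δ ∧ γ < κ.ord ∧
      ∃ ε < γ, nextLimitPt C ε γ ∉ statPts δ κ C ε }
  have hS' := ((IsStat.or (A := N) (B := { β | β ∈ cofAtLeast δ ∧ e β = ε } \ N)
    (hS.mono fun β hβ => (em (β ∈ N)).imp_right fun h => ⟨hβ, h⟩)).resolve_left
    (not_isStat_compl_statPts hδ hreg hC)).inter_Ioi hb
  refine hC.exists_thread (fun c hc => hS'.exists_gt hc) ?_
  rintro β ⟨⟨⟨hβ, hβε⟩, -⟩, hbβ⟩ β' ⟨⟨⟨hβ', -⟩, hβN⟩, -⟩ hβκ hlt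
  have hmem := nextLimitPt_mem
    (hC.self_mem_limitPts hβκ (isSuccLimit_of_mem_cofAtLeast hδ hβ')) hlt.le
  have hv : nextLimitPt C β β' ∈ statPts δ κ C β := by
    by_contra h
    exact hβN ⟨hβ', hβκ, β, hlt, h⟩
  by_cases heq : nextLimitPt C β β' = β
  · rw [heq] at hmem
    exact hmem.1
  · have h := (he β hβ).2 _ hv heq
    rw [hβε] at h
    exact absurd hmem.2 (not_le.2 ((hεb ⟨_, h⟩).trans_lt hbβ))

end StatPts

/-- If `κ > δ` is a regular cardinal carrying a `□(κ)`-sequence, then there is a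
closed unbounded subset of `j_U(κ)` that is fresh over `Ult(V,U)`. -/
theorem stmt12 (δ : Cardinal.{0}) (U : Ultrafilter (Idx δ)) (hU : IsNormalUltrafilter δ U)
    (κ : Cardinal.{0}) (hκ : δ < κ) (hreg : κ.IsRegular)
    (hsq : ∃ C : Ordinal.{0} → Set Ordinal.{0}, IsSquareSeq κ.ord C) :
    ∃ A : Set Ordinal.{0}, ClosedIn A (jU hU κ.ord) ∧ UnbSub A (jU hU κ.ord) ∧
      Fresh hU A := by
  obtain ⟨C, hC⟩ := hsq
  have hC' := hC.isCoherentCSeq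
  by_cases h : ∃ ε, Cardinal.lift.{1} δ ≤ #(statPts δ κ (extendSeq C) ε)
  · obtain ⟨ε, hε⟩ := h
    exact exists_fresh_of_le_mk_statPts hU hκ hreg hC' hε
  · push Not at h
    obtain ⟨D, hD, hDunb, hDC⟩ := exists_thread_of_mk_statPts_lt hU hκ hreg hC' h
    refine absurd ⟨D, hD, hDunb, fun γ hγ hγκ => ?_⟩ hC.nontrivial
    rw [hDC γ hγ hγκ, extendSeq_of_isSuccLimit C (isSuccLimit_of_mem_limitPts hγ)]

end MU
end
end

section
/- Let κ be a singular cardinal. If there exists a □_κ-sequence, then there exists a □_κ-sequence ⟨B_γ : γ ∈ Lim ∩ κ⁺⟩ with otp(B_γ) < κ for all γ ∈ Lim ∩ κ⁺. -/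
noncomputable section

open Cardinal Set

namespace MU

variable {δ : Cardinal.{0}} {U : Ultrafilter (Idx δ)}

/-- The order type of `A ∩ b`, for a set of ordinals `A` and an ordinal `b`. -/
def rk (A : Set Ordinal.{0}) (b : Ordinal.{0}) : Ordinal.{0} :=
  ⨆ a : {a : Iio b // a.1 ∈ A}, rk A a.1.1 + 1
termination_by b
decreasing_by exact a.1.2

section rk

variable {A A' : Set Ordinal.{0}} {a b o x γ : Ordinal.{0}}

theorem rk_lt_rk (ha : a ∈ A) (hab : a < b) : rk A a < rk A b := by
  rw [rk.eq_1 A b]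
  exact Ordinal.lt_iSup_add_one (fun a : {a : Iio b // a.1 ∈ A} => rk A a.1.1) ⟨⟨a, hab⟩, ha⟩

theorem rk_le (h : ∀ a ∈ A, a < b → rk A a < o) : rk A b ≤ o := by
  rw [rk.eq_1 A b]
  exact Ordinal.iSup_le fun a => Order.add_one_le_of_lt (h _ a.2 a.1.2)

theorem rk_mono (hab : a ≤ b) : rk A a ≤ rk A b :=
  rk_le fun _ hc hca => rk_lt_rk hc (hca.trans_le hab)

theorem rk_inj (ha : a ∈ A) (hb : b ∈ A) (h : rk A a = rk A b) : a = b := by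
  rcases lt_trichotomy a b with hab | hab | hab
  · exact absurd h (rk_lt_rk ha hab).ne
  · exact hab
  · exact absurd h (rk_lt_rk hb hab).ne'

theorem exists_rk_eq (hx : x < rk A b) : ∃ a ∈ A, a < b ∧ rk A a = x := by
  induction b using WellFoundedLT.induction with
  | ind b ih =>
    have h : ∃ a ∈ A, a < b ∧ x ≤ rk A a := by
      by_contra! hcon
      exact hx.not_ge (rk_le hcon)
    obtain ⟨a, ha, hab, hxa⟩ := h
    rcases hxa.eq_or_lt with rfl | hlt
    · exact ⟨a, ha, hab, rfl⟩
    · obtain ⟨c, hc, hca, hcx⟩ := ih a hab hlt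
      exact ⟨c, hc, hca.trans hab, hcx⟩

theorem rk_congr (h : A ∩ Iio b = A' ∩ Iio b) (hab : a ≤ b) : rk A a = rk A' a := by
  induction a using WellFoundedLT.induction with
  | ind a ih =>
    have hmem : ∀ c < a, (c ∈ A ↔ c ∈ A') := fun c hc => by
      have := Set.ext_iff.1 h c
      simpa [hc.trans_le hab] using this
    apply le_antisymm
    · refine rk_le fun c hc hca => ?_
      rw [ih c hca (hca.le.trans hab)]
      exact rk_lt_rk ((hmem c hca).1 hc) hca
    · refine rk_le fun c hc hca => ?_
      rw [← ih c hca (hca.le.trans hab)]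
      exact rk_lt_rk ((hmem c hca).2 hc) hca

theorem otpLE.rk_le (h : otpLE A o) (b : Ordinal.{0}) : rk A b ≤ o := by
  obtain ⟨g, hg, hmono⟩ := h
  have key : ∀ a, a ∈ A → rk A a ≤ g a := by
    intro a
    induction a using WellFoundedLT.induction with
    | ind a ih =>
      exact fun ha => MU.rk_le fun c hc hca => (ih c hca hc).trans_lt (hmono c hc a ha hca)
  exact MU.rk_le fun a ha _ => (key a ha).trans_lt (hg a ha)

end rk

/-- A singular cardinal has a closed unbounded subset containing `0` of order type less than
the cardinal. -/
theorem exists_club_otpLT (κ : Cardinal.{0}) (hsing : IsSingular κ) :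
    ∃ E ⊆ Iio κ.ord, otpLT E κ.ord ∧ 0 ∈ E ∧ (∀ x < κ.ord, ∃ e ∈ E, x < e) ∧
      ∀ x < κ.ord, (∀ y < x, ∃ e ∈ E, y < e ∧ e ≤ x) → x ∈ E := by
  have hlim := isSuccLimit_ord hsing.1
  obtain ⟨s, hs, hcard⟩ := Order.exists_cof_eq (Iio κ.ord)
  rw [Ordinal.cof_Iio, ← Ordinal.lift_cof] at hcard
  set S : Set Ordinal.{0} := Subtype.val '' s with hS
  have hθ : rk S κ.ord < κ.ord := by
    rw [lt_ord, ← Cardinal.lift_lt.{0, 1}, ← Cardinal.mk_Iio_ordinal]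
    have h1 : Iio (rk S κ.ord) ⊆ rk S '' S := fun x hx => by
      obtain ⟨a, ha, -, h⟩ := exists_rk_eq hx
      exact ⟨a, ha, h⟩
    calc #(Iio (rk S κ.ord)) ≤ #(rk S '' S) := mk_le_mk_of_subset h1
      _ ≤ #S := mk_image_le
      _ ≤ #s := mk_image_le
      _ < Cardinal.lift.{1} κ := by rw [hcard]; exact Cardinal.lift_lt.2 hsing.2
  refine ⟨{x | x < κ.ord ∧ ∀ y < x, rk S y < rk S x}, fun x hx => hx.1,
    ⟨rk S κ.ord, hθ, rk S, fun x hx => ?_, fun x _ y hy hxy => hy.2 x hxy⟩,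
    ⟨hlim.bot_lt, fun y hy => absurd hy (not_lt_bot (a := y))⟩, fun x hx => ?_,
    fun x hx h => ⟨hx, fun y hy => ?_⟩⟩
  · obtain ⟨c, hc, hxc⟩ := hs ⟨x, hx.1⟩
    exact (rk_mono hxc).trans_lt (rk_lt_rk ⟨c, hc, rfl⟩ c.2)
  · obtain ⟨c, hc, hxc⟩ := hs ⟨x, hx⟩
    refine ⟨Order.succ c.1, ⟨hlim.succ_lt c.2, fun y hy => ?_⟩, Order.lt_succ_of_le hxc⟩
    exact (rk_mono (Order.lt_succ_iff.1 hy)).trans_lt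
      (rk_lt_rk ⟨c, hc, rfl⟩ (Order.lt_succ c.1))
  · obtain ⟨e, he, hye, hex⟩ := h y hy
    exact (he.2 y hye).trans_le (rk_mono hex)

/-- Below a singular cardinal `κ`, every limit ordinal `δ ≤ κ` has a club `T δ` of order type
less than `κ`, coherently along the limit points of these clubs. -/
theorem exists_coherent_clubs (κ : Cardinal.{0}) (hsing : IsSingular κ) :
    ∃ T : Ordinal.{0} → Set Ordinal.{0},
      (∀ δ ≤ κ.ord, T δ ⊆ Iio δ) ∧
      (∀ δ ≤ κ.ord, Order.IsSuccLimit δ → ∀ x < δ, ∃ t ∈ T δ, x < t) ∧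
      (∀ δ ≤ κ.ord, ∀ x < δ, x ≠ 0 → (∀ y < x, ∃ t ∈ T δ, y < t ∧ t ≤ x) → x ∈ T δ) ∧
      (∀ δ ≤ κ.ord, ∀ δ' < δ, δ' ≠ 0 → (∀ y < δ', ∃ t ∈ T δ, y < t ∧ t < δ') →
        T δ' = T δ ∩ Iio δ') ∧
      ∀ δ ≤ κ.ord, otpLT (T δ) κ.ord := by
  classical
  obtain ⟨E, hEκ, ⟨θ, hθ, g, hg, hgmono⟩, h0, hunb, hcl⟩ := exists_club_otpLT κ hsing
  set ε : Ordinal.{0} → Ordinal.{0} := fun δ => sSup (E ∩ Iio δ) with hε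
  have hbdd : ∀ δ, BddAbove (E ∩ Iio δ) := fun δ => ⟨δ, fun x hx => hx.2.le⟩
  have hne : ∀ δ, δ ≠ 0 → (E ∩ Iio δ).Nonempty := fun δ hδ => ⟨0, h0, pos_iff_ne_zero.2 hδ⟩
  have hεle : ∀ δ, ε δ ≤ δ := fun δ => csSup_le' fun x hx => hx.2.le
  have hleε : ∀ δ, ∀ e ∈ E, e < δ → e ≤ ε δ := fun δ e he h => le_csSup (hbdd δ) ⟨he, h⟩
  have hltε : ∀ δ, ∀ x < ε δ, ∃ e ∈ E, e < δ ∧ x < e := fun δ x hx => by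
    by_contra! hcon
    exact hx.not_ge (csSup_le' fun e he => hcon e he.1 he.2)
  have hεeq : ∀ δ, (∀ x < δ, ∃ e ∈ E, x < e ∧ e < δ) → ε δ = δ := fun δ h => by
    refine (hεle δ).antisymm (not_lt.1 fun hlt => ?_)
    obtain ⟨e, he, h1, h2⟩ := h _ hlt
    exact h1.not_ge (hleε δ e he h2)
  have hεκ : ε κ.ord = κ.ord := hεeq _ fun x hx => by
    obtain ⟨e, he, hxe⟩ := hunb x hx
    exact ⟨e, he, hxe, hEκ he⟩
  refine ⟨fun δ => if ε δ = δ then E ∩ Iio δ else Ioo (ε δ) δ, fun δ _ => ?_,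
    fun δ hδ hlim x hx => ?_, fun δ hδ x hx hx0 h => ?_, fun δ hδ δ' hlt hδ0 h => ?_,
    fun δ hδ => ?_⟩
  · dsimp only
    split_ifs
    · exact inter_subset_right
    · exact fun x hx => hx.2
  · dsimp only
    split_ifs with hc
    · obtain ⟨e, he, h1, h2⟩ := hltε δ x (hc.symm ▸ hx)
      exact ⟨e, ⟨he, h1⟩, h2⟩
    · have hm : max x (ε δ) < δ := max_lt hx ((hεle δ).lt_of_ne hc)
      exact ⟨Order.succ (max x (ε δ)),
        ⟨Order.lt_succ_of_le (le_max_right _ _), hlim.succ_lt hm⟩,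
        Order.lt_succ_of_le (le_max_left _ _)⟩
  · dsimp only at h ⊢
    split_ifs at h ⊢ with hc
    · refine ⟨hcl x (hx.trans_le hδ) fun y hy => ?_, hx⟩
      obtain ⟨t, ht, h1⟩ := h y hy
      exact ⟨t, ht.1, h1⟩
    · obtain ⟨t, ht, -, h2⟩ := h 0 (pos_iff_ne_zero.2 hx0)
      exact ⟨ht.1.trans_le h2, hx⟩
  · dsimp only at h ⊢
    by_cases hc : ε δ = δ
    · simp only [if_pos hc] at h ⊢
      have hc' : ε δ' = δ' := hεeq _ fun x hx => by
        obtain ⟨t, ht, h1⟩ := h x hx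
        exact ⟨t, ht.1, h1⟩
      rw [if_pos hc', inter_assoc, Iio_inter_Iio, min_eq_right hlt.le]
    · simp only [if_neg hc] at h ⊢
      obtain ⟨t, ht, -, h2⟩ := h 0 (pos_iff_ne_zero.2 hδ0)
      have hlt' : ε δ < δ' := ht.1.trans h2
      have heq : E ∩ Iio δ' = E ∩ Iio δ := by
        ext e
        exact ⟨fun he => ⟨he.1, he.2.trans hlt⟩,
          fun he => ⟨he.1, (hleε δ e he.1 he.2).trans_lt hlt'⟩⟩
      have hεε : ε δ' = ε δ := by simp only [hε, heq]
      rw [if_neg (by rw [hεε]; exact hlt'.ne), hεε]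
      ext x
      exact ⟨fun hx => ⟨⟨hx.1, hx.2.trans hlt⟩, hx.2⟩, fun hx => ⟨hx.1.1, hx.2⟩⟩
  · dsimp only
    split_ifs with hc
    · exact ⟨θ, hθ, g, fun a ha => hg a ha.1, fun a ha b hb => hgmono a ha.1 b hb.1⟩
    · have hlt : δ < κ.ord := hδ.lt_of_ne fun h => hc (h ▸ hεκ)
      exact ⟨δ, hlt, id, fun a ha => ha.2, fun a _ b _ hab => hab⟩

/-- A sequence of sets of order type less than `κ` is not threaded by an unbounded subset
of `κ⁺`. -/
theorem not_exists_thread {κ : Cardinal.{0}} (hκ : ℵ₀ ≤ κ) {B : Ordinal.{0} → Set Ordinal.{0}}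
    (hB : ∀ γ < (Order.succ κ).ord, Order.IsSuccLimit γ → otpLE (B γ) κ.ord) :
    ¬ ∃ D : Set Ordinal.{0}, ClosedIn D (Order.succ κ).ord ∧ UnbSub D (Order.succ κ).ord ∧
      ∀ γ ∈ limitPts D, γ < (Order.succ κ).ord → D ∩ Iio γ = B γ := by
  rintro ⟨D, -, ⟨hD, hunb⟩, hthread⟩
  have hreg := isRegular_succ hκ
  have hlim := isSuccLimit_ord hreg.1
  have hrk : ∀ a ∈ D, rk D a < κ.ord := by
    intro a ha
    have hnext : ∀ x : Iio (Order.succ κ).ord, ∃ y : Iio (Order.succ κ).ord, y.1 ∈ D ∧ x < y := by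
      intro x
      obtain ⟨y, hy, hxy⟩ := hunb _ (hlim.succ_lt x.2)
      exact ⟨⟨y, hD hy⟩, hy, show x.1 < y from Order.succ_le_iff.1 hxy⟩
    choose f hfD hf using hnext
    let u : ℕ → Iio (Order.succ κ).ord := fun n => f^[n] ⟨a, hD ha⟩
    have husucc : ∀ n, u n < u (n + 1) := fun n => by
      simp only [u, Function.iterate_succ_apply']
      exact hf _
    have huD : ∀ n, (u n).1 ∈ D := fun n => by
      cases n with
      | zero => exact ha
      | succ n => simp only [u, Function.iterate_succ_apply']; exact hfD _
    set γ : Ordinal.{0} := ⨆ n, (u n).1 with hγ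
    have hγlt : γ < (Order.succ κ).ord := by
      refine Ordinal.iSup_lt_of_lt_cof ?_ fun n => (u n).2
      rw [hreg.cof_ord, mk_nat]
      exact hκ.trans_lt (Order.lt_succ κ)
    have hult : ∀ n, (u n).1 < γ := fun n =>
      lt_of_lt_of_le (husucc n) (Ordinal.le_iSup (fun n => (u n).1) (n + 1))
    have hγD : γ ∈ limitPts D := by
      refine ⟨⟨a, ha, hult 0⟩, le_antisymm (csSup_le' fun x hx => hx.2.le) ?_⟩
      exact Ordinal.iSup_le fun n => le_csSup ⟨γ, fun x hx => hx.2.le⟩ ⟨huD n, hult n⟩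
    have hγlim : Order.IsSuccLimit γ := by
      rw [Ordinal.isSuccLimit_iff, Order.isSuccPrelimit_iff_succ_lt]
      refine ⟨(pos_of_gt (hult 0)).ne', fun x hx => ?_⟩
      obtain ⟨n, hn⟩ := Ordinal.lt_iSup_iff.1 hx
      exact (Order.succ_le_of_lt hn).trans_lt (hult n)
    have hle := (hB γ hγlt hγlim).rk_le γ
    rw [← hthread γ hγD hγlt, ← rk_congr (A := D) (b := γ) (by rw [inter_assoc, inter_self]) le_rfl]
      at hle
    exact (rk_lt_rk ha (hult 0)).trans_le hle
  have hcard : #D ≤ Cardinal.lift.{1} κ := by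
    have : #D ≤ #(Iio κ.ord) := mk_le_of_injective (f := fun a : D => ⟨rk D a, hrk a a.2⟩)
      fun a b h => Subtype.ext (rk_inj a.2 b.2 (congrArg Subtype.val h))
    rwa [Cardinal.mk_Iio_ordinal, card_ord] at this
  have hsup : sSup D < (Order.succ κ).ord := by
    refine Ordinal.sSup_lt_of_lt_cof ?_ fun x hx => hD hx
    rw [← Ordinal.lift_cof, hreg.cof_ord]
    exact hcard.trans_lt (Cardinal.lift_lt.2 (Order.lt_succ κ))
  obtain ⟨a, ha, hle⟩ := hunb _ (hlim.succ_lt hsup)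
  exact (Order.succ_le_iff.1 hle).not_ge (le_csSup ⟨_, fun x hx => (hD hx).le⟩ ha)

section thinning

variable {A : Set Ordinal.{0}} {a β γ : Ordinal.{0}}

theorem exists_mem_gt (hβ : β ∈ limitPts A) (ha : a < β) : ∃ c ∈ A, c < β ∧ a < c := by
  by_contra! hcon
  exact (ha.trans_eq hβ.2.symm).not_ge (csSup_le' fun c hc => hcon c hc.1 hc.2)

theorem limitPts_mono {A' : Set Ordinal.{0}} (h : A' ⊆ A) : limitPts A' ⊆ limitPts A := by
  rintro β ⟨hne, hsup⟩
  have hsub : A' ∩ Iio β ⊆ A ∩ Iio β := inter_subset_inter_left _ h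
  refine ⟨hne.mono hsub, le_antisymm (csSup_le' fun x hx => hx.2.le) ?_⟩
  exact hsup.symm.trans_le (csSup_le_csSup ⟨β, fun x hx => hx.2.le⟩ hne hsub)

theorem rk_pos (ha : a ∈ A) (hab : a < β) : rk A β ≠ 0 :=
  (pos_of_gt (rk_lt_rk ha hab)).ne'

theorem isSuccLimit_rk (hγ : Order.IsSuccLimit γ) (hA : UnbSub A γ) :
    Order.IsSuccLimit (rk A γ) := by
  obtain ⟨a, ha, -⟩ := hA.2 0 hγ.bot_lt
  rw [Ordinal.isSuccLimit_iff, Order.isSuccPrelimit_iff_succ_lt]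
  refine ⟨rk_pos ha (hA.1 ha), fun x hx => ?_⟩
  obtain ⟨c, hc, hcγ, rfl⟩ := exists_rk_eq hx
  obtain ⟨d, hd, hcd⟩ := hA.2 _ (hγ.succ_lt hcγ)
  exact (Order.succ_le_of_lt (rk_lt_rk hc (Order.succ_le_iff.1 hcd))).trans_lt
    (rk_lt_rk hd (hA.1 hd))

end thinning

/-- If `κ` is a singular cardinal carrying a `□_κ`-sequence, then there is a
`□_κ`-sequence `B` with `otp(B_γ) < κ` for every limit `γ < κ⁺`. -/
theorem stmt15 (κ : Cardinal.{0}) (hsing : IsSingular κ)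
    (hsq : ∃ C : Ordinal.{0} → Set Ordinal.{0}, IsSquareKappaSeq κ C) :
    ∃ B : Ordinal.{0} → Set Ordinal.{0}, IsSquareKappaSeq κ B ∧
      ∀ γ < (Order.succ κ).ord, Order.IsSuccLimit γ → otpLT (B γ) κ.ord := by
  obtain ⟨C, hC, hotp⟩ := hsq
  obtain ⟨T, hTsub, hTunb, hTcl, hTcoh, hTotp⟩ := exists_coherent_clubs κ hsing
  set B : Ordinal.{0} → Set Ordinal.{0} :=
    fun γ => {β | β ∈ C γ ∧ rk (C γ) β ∈ T (rk (C γ) γ)} with hBdef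
  have hBC : ∀ γ, B γ ⊆ C γ := fun γ β hβ => hβ.1
  have hB : ∀ γ < (Order.succ κ).ord, Order.IsSuccLimit γ → otpLT (B γ) κ.ord := by
    intro γ hγ hlim
    obtain ⟨o, ho, g, hg, hgmono⟩ := hTotp _ ((hotp γ hγ hlim).rk_le γ)
    exact ⟨o, ho, fun a => g (rk (C γ) a), fun a ha => hg _ ha.2,
      fun a ha b hb hab => hgmono _ ha.2 _ hb.2 (rk_lt_rk ha.1 hab)⟩
  have hB' : ∀ γ < (Order.succ κ).ord, Order.IsSuccLimit γ → otpLE (B γ) κ.ord := by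
    intro γ hγ hlim
    obtain ⟨o, ho, g, hg, hgmono⟩ := hB γ hγ hlim
    exact ⟨g, fun a ha => (hg a ha).trans ho, hgmono⟩
  refine ⟨B, ⟨⟨fun γ hγ hlim S hS hne hlt => ?_, fun γ hγ hlim => ⟨?_, fun b hb => ?_⟩,
    fun γ hγ hlim β hβ hlt => ?_, not_exists_thread hsing.1 hB'⟩, hB'⟩, hB⟩
  · have hCγ := hC.unbounded γ hγ hlim
    have hbdd : BddAbove S := ⟨γ, fun x hx => (hCγ.1 (hS hx).1).le⟩
    by_cases hmem : sSup S ∈ S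
    · exact hS hmem
    have hs : sSup S ∈ C γ := hC.closed γ hγ hlim S (hS.trans (hBC γ)) hne hlt
    have hltS : ∀ x ∈ S, x < sSup S := fun x hx =>
      (le_csSup hbdd hx).lt_of_ne fun h => hmem (h ▸ hx)
    obtain ⟨x₀, hx₀⟩ := hne
    refine ⟨hs, hTcl _ ((hotp γ hγ hlim).rk_le γ) _ (rk_lt_rk hs hlt)
      (rk_pos (hS hx₀).1 (hltS _ hx₀)) fun y hy => ?_⟩
    obtain ⟨a, ha, has, rfl⟩ := exists_rk_eq hy
    obtain ⟨b, hb, hab⟩ := exists_lt_of_lt_csSup ⟨x₀, hx₀⟩ has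
    exact ⟨_, (hS hb).2, rk_lt_rk ha hab, rk_mono (hltS b hb).le⟩
  · exact (hBC γ).trans (hC.unbounded γ hγ hlim).1
  · have hCγ := hC.unbounded γ hγ hlim
    obtain ⟨a, ha, hba⟩ := hCγ.2 b hb
    have hδ := (hotp γ hγ hlim).rk_le γ
    obtain ⟨t, ht, hat⟩ := hTunb _ hδ (isSuccLimit_rk hlim hCγ) _ (rk_lt_rk ha (hCγ.1 ha))
    obtain ⟨c, hc, -, rfl⟩ := exists_rk_eq (hTsub _ hδ ht)
    exact ⟨c, ⟨hc, ht⟩, hba.trans (not_lt.1 fun h => hat.not_ge (rk_mono h.le))⟩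
  · have hβC := limitPts_mono (hBC γ) hβ
    have hcoh := hC.coherent γ hγ hlim β hβC hlt
    have hrk : ∀ x ≤ β, rk (C β) x = rk (C γ) x := fun x hx =>
      rk_congr (b := β) (by rw [hcoh, inter_assoc, inter_self]) hx
    have hδlt : rk (C γ) β < rk (C γ) γ := by
      obtain ⟨c, hc, hβc⟩ := (hC.unbounded γ hγ hlim).2 β hlt
      exact (rk_mono hβc).trans_lt (rk_lt_rk hc ((hC.unbounded γ hγ hlim).1 hc))
    obtain ⟨x₀, hx₀, hx₀β⟩ := hβ.1
    have hT := hTcoh _ ((hotp γ hγ hlim).rk_le γ) _ hδlt (rk_pos hx₀.1 hx₀β) fun y hy => by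
      obtain ⟨a, ha, haβ, rfl⟩ := exists_rk_eq hy
      obtain ⟨c, hc, hcβ, hac⟩ := exists_mem_gt hβ haβ
      exact ⟨_, hc.2, rk_lt_rk ha hac, rk_lt_rk hc.1 hcβ⟩
    ext x
    constructor
    · rintro ⟨hx, hxT⟩
      rw [hcoh] at hx
      rw [hrk β le_rfl, hrk x hx.2.le, hT] at hxT
      exact ⟨⟨hx.1, hxT.1⟩, hx.2⟩
    · rintro ⟨⟨hx, hxT⟩, hxβ⟩
      refine ⟨hcoh ▸ ⟨hx, hxβ⟩, ?_⟩
      rw [hrk β le_rfl, hrk x hxβ.le, hT]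
      exact ⟨hxT, rk_lt_rk hx hxβ⟩

end MU
end
end
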